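/- arXiv:math/0603197 — 7 statements merged into one kernel-verified Lean document; each statement's English description precedes it below -/
import Mathlib

section
/- For all n, m ≥ 1, the spaces Hom(ℤ^n, U(m)) and Hom(ℤ^n, SU(m)) of ordered commuting n-tuples in the unitary group U(m) and in the special unitary group SU(m) are path-connected. -/
open Matrix Module.End in
/-- A commuting family of Hermitian matrices has an orthonormal basis of joint eigenvectors. -/
theorem Matrix.exists_orthonormalBasis_joint_eigenvectors {ι : Type*} {m : ℕ}
    (A : ι → Matrix (Fin m) (Fin m) ℂ) (hA : ∀ i, (A i).IsHermitian)
    (hC : ∀ i j, Commute (A i) (A j)) :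
    ∃ (b : OrthonormalBasis (Fin m) ℂ (EuclideanSpace ℂ (Fin m))) (μ : ι → Fin m → ℂ),
      ∀ i k, A i *ᵥ (b k).ofLp = μ i k • (b k).ofLp := by
  classical
  let T : ι → Module.End ℂ (EuclideanSpace ℂ (Fin m)) := fun i => (A i).toEuclideanLin
  have hT : ∀ i, (T i).IsSymmetric := fun i => isSymmetric_toEuclideanLin_iff.mpr (hA i)
  have hTC : Pairwise (Function.onFun Commute T) := by
    intro i j _
    refine LinearMap.ext fun x => WithLp.ofLp_injective 2 ?_
    simp [T, (hC i j).eq]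
  let W : (ι → ℂ) → Submodule ℂ (EuclideanSpace ℂ (Fin m)) :=
    fun γ => ⨅ j, eigenspace (T j) (γ j)
  have hI : DirectSum.IsInternal W :=
    LinearMap.IsSymmetric.directSum_isInternal_of_pairwise_commute hT hTC
  have hO := LinearMap.IsSymmetric.orthogonalFamily_iInf_eigenspaces hT
  let _ : Fintype {γ // W γ ≠ ⊥} :=
    hI.submodule_iSupIndep.fintypeNeBotOfFiniteDimensional
  have hI' : DirectSum.IsInternal fun γ : {γ // W γ ≠ ⊥} => W γ :=
    DirectSum.isInternal_ne_bot_iff.mpr hI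
  have hO' : OrthogonalFamily ℂ (fun γ : {γ // W γ ≠ ⊥} => W γ) fun γ => (W γ).subtypeₗᵢ :=
    hO.comp Subtype.val_injective
  have hn : Module.finrank ℂ (EuclideanSpace ℂ (Fin m)) = m := finrank_euclideanSpace_fin
  refine ⟨hI'.subordinateOrthonormalBasis hn hO',
    fun i k => (hI'.subordinateOrthonormalBasisIndex hn k hO').1 i, fun i k => ?_⟩
  have h := hI'.subordinateOrthonormalBasis_subordinate hn k hO'
  have h' := mem_eigenspace_iff.mp ((Submodule.mem_iInf _).mp h i)
  exact congrArg WithLp.ofLp h'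

open Matrix in
/-- A commuting family of unitary matrices is simultaneously unitarily diagonalizable. -/
theorem Matrix.exists_unitary_simultaneous_diagonalization {ι : Type*} {m : ℕ}
    (A : ι → Matrix (Fin m) (Fin m) ℂ) (hA : ∀ i, A i ∈ unitaryGroup (Fin m) ℂ)
    (hC : ∀ i j, Commute (A i) (A j)) :
    ∃ V ∈ unitaryGroup (Fin m) ℂ, ∃ d : ι → Fin m → ℂ,
      ∀ i, A i = V * diagonal (d i) * star V := by
  have hCs : ∀ i j, Commute (A i) (star (A j)) := fun i j => by
    have h₁ := mem_unitaryGroup_iff.mp (hA j)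
    have h₂ := mem_unitaryGroup_iff'.mp (hA j)
    calc A i * star (A j) = star (A j) * (A j * A i) * star (A j) := by
          rw [← mul_assoc (star (A j)), h₂, one_mul]
      _ = star (A j) * A i := by rw [← (hC i j).eq, mul_assoc, mul_assoc (A i), h₁, mul_one]
  have hss : ∀ i j, Commute (star (A i)) (star (A j)) := fun i j => (hC i j).star_star
  let B : ι × Bool → Matrix (Fin m) (Fin m) ℂ := fun p =>
    if p.2 then A p.1 + star (A p.1) else Complex.I • (A p.1 - star (A p.1))
  have hB : ∀ p, (B p).IsHermitian := by
    rintro ⟨i, _ | _⟩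
    · simp [B, IsHermitian, ← star_eq_conjTranspose, ← smul_neg]
    · simp [B, IsHermitian, ← star_eq_conjTranspose, add_comm]
  have hBC : ∀ p q, Commute (B p) (B q) := by
    have h₁ : ∀ i j, Commute (star (A i)) (A j) := fun i j => (hCs j i).symm
    rintro ⟨i, _ | _⟩ ⟨j, _ | _⟩ <;> simp only [B, if_true, Bool.false_eq_true, if_false]
    · exact (((hC i j).sub_left (h₁ i j)).sub_right
        ((hCs i j).sub_left (hss i j))).smul_left _ |>.smul_right _
    · exact (((hC i j).sub_left (h₁ i j)).add_right
        ((hCs i j).sub_left (hss i j))).smul_left _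
    · exact (((hC i j).add_left (h₁ i j)).sub_right
        ((hCs i j).add_left (hss i j))).smul_right _
    · exact ((hC i j).add_left (h₁ i j)).add_right ((hCs i j).add_left (hss i j))
  obtain ⟨b, μ, hμ⟩ := exists_orthonormalBasis_joint_eigenvectors B hB hBC
  let V : Matrix (Fin m) (Fin m) ℂ := (EuclideanSpace.basisFun (Fin m) ℂ).toBasis.toMatrix b
  have hV : V ∈ unitaryGroup (Fin m) ℂ :=
    (EuclideanSpace.basisFun (Fin m) ℂ).toMatrix_orthonormalBasis_mem_unitary b
  let d : ι → Fin m → ℂ := fun i k => (μ (i, true) k - Complex.I * μ (i, false) k) / 2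
  have hAB : ∀ i, A i = (2⁻¹ : ℂ) • (B (i, true) - Complex.I • B (i, false)) := fun i => by
    simp only [B, if_true, Bool.false_eq_true, if_false, smul_smul, Complex.I_mul_I]
    rw [neg_one_smul, sub_neg_eq_add, add_add_sub_cancel, ← two_smul ℂ (A i), smul_smul]
    norm_num
  have hAb : ∀ i k, A i *ᵥ (b k).ofLp = d i k • (b k).ofLp := fun i k => by
    rw [hAB, smul_mulVec, sub_mulVec, smul_mulVec, hμ, hμ, smul_smul, ← sub_smul, smul_smul]
    congr 1
    simp only [d]
    ring
  have hAV : ∀ i, A i * V = V * diagonal (d i) := fun i => by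
    ext r k
    rw [mul_diagonal]
    have h := congrFun (hAb i k) r
    simpa [V, Module.Basis.toMatrix_apply, mul_apply, mulVec, dotProduct, mul_comm] using h
  refine ⟨V, hV, d, fun i => ?_⟩
  rw [← hAV, mul_assoc, mem_unitaryGroup_iff.mp hV, mul_one]

/-- Conjugates by a unitary matrix of diagonal matrices with entries on the unit circle. -/
noncomputable def Matrix.conjTorus {m : ℕ} (V : Matrix (Fin m) (Fin m) ℂ) (θ : Fin m → ℝ) :
    Matrix (Fin m) (Fin m) ℂ :=
  V * diagonal (fun k => Complex.exp (θ k * Complex.I)) * star V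

namespace Matrix

variable {m : ℕ} {V : Matrix (Fin m) (Fin m) ℂ}

theorem conjTorus_mul (hV : V ∈ unitaryGroup (Fin m) ℂ) (θ η : Fin m → ℝ) :
    conjTorus V θ * conjTorus V η = conjTorus V (θ + η) := by
  have h := mem_unitaryGroup_iff'.mp hV
  calc conjTorus V θ * conjTorus V η
      = V * diagonal (fun k => Complex.exp (θ k * Complex.I)) * (star V * V) *
        diagonal (fun k => Complex.exp (η k * Complex.I)) * star V := by
        simp only [conjTorus, mul_assoc]
    _ = conjTorus V (θ + η) := by
        rw [h, mul_one, mul_assoc V, diagonal_mul_diagonal]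
        simp [conjTorus, add_mul, Complex.exp_add]

theorem conjTorus_zero (hV : V ∈ unitaryGroup (Fin m) ℂ) : conjTorus V 0 = 1 := by
  simp [conjTorus, mem_unitaryGroup_iff.mp hV]

theorem star_conjTorus (θ : Fin m → ℝ) : star (conjTorus V θ) = conjTorus V (-θ) := by
  simp only [conjTorus, star_mul, star_star, mul_assoc]
  congr 2
  simp only [star_eq_conjTranspose, diagonal_conjTranspose]
  congr 1
  ext k
  simp [← Complex.exp_conj]

theorem conjTorus_mem_unitaryGroup (hV : V ∈ unitaryGroup (Fin m) ℂ) (θ : Fin m → ℝ) :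
    conjTorus V θ ∈ unitaryGroup (Fin m) ℂ := by
  rw [mem_unitaryGroup_iff, star_conjTorus, conjTorus_mul hV, add_neg_cancel, conjTorus_zero hV]

theorem det_conjTorus (hV : V ∈ unitaryGroup (Fin m) ℂ) (θ : Fin m → ℝ) :
    (conjTorus V θ).det = Complex.exp ((∑ k, θ k : ℝ) * Complex.I) := by
  have h : V.det * (star V).det = 1 := by rw [← det_mul, mem_unitaryGroup_iff.mp hV, det_one]
  rw [conjTorus, det_mul, det_mul, det_diagonal, mul_right_comm, h, one_mul,
    ← Complex.exp_sum, ← Finset.sum_mul]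
  push_cast
  rfl

@[fun_prop]
theorem continuous_conjTorus (V : Matrix (Fin m) (Fin m) ℂ) : Continuous (conjTorus V) := by
  unfold conjTorus
  fun_prop

/-- Commuting unitary matrices lie in a common conjugate of the diagonal torus. -/
theorem exists_eq_conjTorus {ι : Type*} (A : ι → Matrix (Fin m) (Fin m) ℂ)
    (hA : ∀ i, A i ∈ unitaryGroup (Fin m) ℂ) (hC : ∀ i j, Commute (A i) (A j)) :
    ∃ V ∈ unitaryGroup (Fin m) ℂ, ∃ θ : ι → Fin m → ℝ, ∀ i, A i = conjTorus V (θ i) := by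
  obtain ⟨V, hV, d, hd⟩ := exists_unitary_simultaneous_diagonalization A hA hC
  refine ⟨V, hV, fun i k => (d i k).arg, fun i => ?_⟩
  have hD : diagonal (d i) ∈ unitaryGroup (Fin m) ℂ := by
    have h : diagonal (d i) = star V * A i * V := by
      rw [hd, mul_assoc V, ← mul_assoc (star V), mem_unitaryGroup_iff'.mp hV, one_mul, mul_assoc,
        mem_unitaryGroup_iff'.mp hV, mul_one]
    rw [h]
    exact mul_mem (mul_mem (Unitary.star_mem hV) (hA i)) hV
  have hn : ∀ k, ‖d i k‖ = 1 := fun k => by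
    have h := congrFun (congrFun (mem_unitaryGroup_iff.mp hD) k) k
    simp only [star_eq_conjTranspose, diagonal_conjTranspose, diagonal_mul_diagonal,
      diagonal_apply_eq, one_apply_eq, Pi.star_apply, RCLike.star_def, Complex.mul_conj'] at h
    exact (pow_eq_one_iff_of_nonneg (norm_nonneg _) two_ne_zero).mp (by exact_mod_cast h)
  rw [hd, conjTorus]
  congr 3
  ext k
  have h := Complex.norm_mul_exp_arg_mul_I (d i k)
  rw [hn, Complex.ofReal_one, one_mul] at h
  exact h.symm

/-- In determinant one the angles can be chosen with sum zero. -/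
theorem exists_eq_conjTorus_sum_eq_zero (hm : 1 ≤ m) {ι : Type*}
    (A : ι → Matrix (Fin m) (Fin m) ℂ) (hA : ∀ i, A i ∈ specialUnitaryGroup (Fin m) ℂ)
    (hC : ∀ i j, Commute (A i) (A j)) :
    ∃ V ∈ unitaryGroup (Fin m) ℂ, ∃ θ : ι → Fin m → ℝ,
      (∀ i, A i = conjTorus V (θ i)) ∧ ∀ i, ∑ k, θ i k = 0 := by
  obtain ⟨V, hV, θ, hθ⟩ := exists_eq_conjTorus A (fun i => (hA i).1) hC
  have hN : ∀ i, ∃ N : ℤ, ∑ k, θ i k = N * (2 * Real.pi) := fun i => by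
    have h : (A i).det = 1 := (hA i).2
    rw [hθ, det_conjTorus hV, Complex.exp_eq_one_iff] at h
    obtain ⟨N, hN⟩ := h
    refine ⟨N, ?_⟩
    rw [← mul_assoc] at hN
    have h : ((∑ k, θ i k : ℝ) : ℂ) = N * (2 * Real.pi) :=
      mul_right_cancel₀ Complex.I_ne_zero hN
    exact_mod_cast h
  choose N hN using hN
  let k₀ : Fin m := ⟨0, hm⟩
  refine ⟨V, hV, fun i => θ i - Pi.single k₀ (N i * (2 * Real.pi)), fun i => ?_, fun i => ?_⟩
  · rw [hθ, conjTorus, conjTorus]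
    congr 3
    ext k
    by_cases hk : k = k₀
    · subst hk
      rw [Complex.exp_eq_exp_iff_exists_int]
      refine ⟨N i, ?_⟩
      simp
      ring
    · simp [hk]
  · simp [hN]

end Matrix

/-- For all `n, m ≥ 1`, the spaces of ordered commuting `n`-tuples in the unitary group
`U(m)` and in the special unitary group `SU(m)` (subspaces of `U(m)ⁿ` resp. `SU(m)ⁿ`) are
path-connected. -/
theorem commutingTuples_unitary_pathConnected (n m : ℕ) (hn : 1 ≤ n) (hm : 1 ≤ m) :
    IsPathConnected {g : Fin n → Matrix.unitaryGroup (Fin m) ℂ |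
        ∀ i j, g i * g j = g j * g i} ∧
    IsPathConnected {g : Fin n → {A : Matrix (Fin m) (Fin m) ℂ //
          A ∈ Matrix.specialUnitaryGroup (Fin m) ℂ} |
        ∀ i j, (g i).1 * (g j).1 = (g j).1 * (g i).1} := by
  constructor
  · refine ⟨1, by simp, fun {g} hg => ?_⟩
    obtain ⟨V, hV, θ, hθ⟩ := Matrix.exists_eq_conjTorus (fun i => (g i).1) (fun i => (g i).2)
      fun i j => congrArg Subtype.val (hg i j)
    refine JoinedIn.ofLine (f := fun t i =>
      ⟨Matrix.conjTorus V (t • θ i), Matrix.conjTorus_mem_unitaryGroup hV _⟩) ?_ ?_ ?_ ?_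
    · refine Continuous.continuousOn (continuous_pi fun i => Continuous.subtype_mk ?_ _)
      fun_prop
    · ext1 i
      exact Subtype.ext (by simpa using Matrix.conjTorus_zero hV)
    · ext1 i
      exact Subtype.ext (by simpa using (hθ i).symm)
    · rintro _ ⟨t, -, rfl⟩ i j
      exact Subtype.ext (by simp [Matrix.conjTorus_mul hV, add_comm])
  · refine ⟨fun _ => ⟨1, one_mem _⟩, by simp, fun {g} hg => ?_⟩
    obtain ⟨V, hV, θ, hθ, hsum⟩ := Matrix.exists_eq_conjTorus_sum_eq_zero hm
      (fun i => (g i).1) (fun i => (g i).2) hg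
    refine JoinedIn.ofLine (f := fun t i => ⟨Matrix.conjTorus V (t • θ i),
      Matrix.conjTorus_mem_unitaryGroup hV _, ?_⟩) ?_ ?_ ?_ ?_
    · change (Matrix.conjTorus V (t • θ i)).det = 1
      simp [Matrix.det_conjTorus hV, ← Finset.mul_sum, hsum]
    · refine Continuous.continuousOn (continuous_pi fun i => Continuous.subtype_mk ?_ _)
      fun_prop
    · ext1 i
      exact Subtype.ext (by simpa using Matrix.conjTorus_zero hV)
    · ext1 i
      exact Subtype.ext (by simpa using (hθ i).symm)
    · rintro _ ⟨t, -, rfl⟩ i j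
      simp [Matrix.conjTorus_mul hV, add_comm]
end

section
/- Let n ≥ 6 and let g₁, …, g_{n−1} be elements of SO(3) satisfying the braid relations: gᵢ gⱼ = gⱼ gᵢ whenever |i − j| ≥ 2, and gᵢ g_{i+1} gᵢ = g_{i+1} gᵢ g_{i+1} for 1 ≤ i ≤ n−2. Then g₁ = g₂ = ⋯ = g_{n−1}. (Consequently, every homomorphism from Artin's braid group B_n to SO(3) factors through the abelianization ℤ of B_n.) -/
open Matrix

namespace BraidSO3

/-- Commuting invertible elements satisfying the braid relation are equal. -/
lemma eq_of_commute_of_braid {M : Type*} [Monoid M] {a b : M} (ha : IsUnit a) (hb : IsUnit b)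
    (hcomm : a * b = b * a) (hbraid : a * b * a = b * a * b) : a = b := by
  apply (ha.mul hb).mul_right_cancel
  rw [← mul_assoc b, ← hbraid, mul_assoc, ← hcomm]

/-- In a finite braid sequence of invertible elements, a single coincidence of neighbours forces
all terms to be equal. -/
lemma braid_sequence_eq {M : Type*} [Monoid M] {m : ℕ} {g : ℕ → M}
    (hunit : ∀ i < m, IsUnit (g i))
    (hfar : ∀ i j, i + 2 ≤ j → j < m → g i * g j = g j * g i)
    (hbraid : ∀ i, i + 1 < m → g i * g (i + 1) * g i = g (i + 1) * g i * g (i + 1))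
    {k : ℕ} (hk : k + 1 < m) (heq : g k = g (k + 1)) :
    ∀ i < m, g i = g 0 := by
  have up : ∀ i, i + 2 < m → g i = g (i + 1) → g (i + 1) = g (i + 2) := fun i hi h =>
    eq_of_commute_of_braid (hunit _ (by omega)) (hunit _ hi)
      (h ▸ hfar i (i + 2) le_rfl hi) (hbraid (i + 1) hi)
  have down : ∀ i, i + 2 < m → g (i + 1) = g (i + 2) → g i = g (i + 1) := fun i hi h =>
    eq_of_commute_of_braid (hunit _ (by omega)) (hunit _ (by omega))
      (h ▸ hfar i (i + 2) le_rfl hi) (hbraid i (by omega))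
  have base : g 0 = g 1 := by
    induction k with
    | zero => exact heq
    | succ k ih => exact ih (by omega) (down k hk heq)
  have next : ∀ i, i + 1 < m → g i = g (i + 1) := by
    intro i hi
    induction i with
    | zero => exact base
    | succ i ih => exact up i hi (ih (by omega))
  intro i hi
  induction i with
  | zero => rfl
  | succ i ih => rw [← next i hi, ih (by omega)]

/-- The braid relation transports involutivity. -/
lemma sq_eq_one_of_braid {M : Type*} [Monoid M] {a b : M} (ha : IsUnit a) (hb : IsUnit b)
    (hbraid : a * b * a = b * a * b) (haa : a * a = 1) : b * b = 1 := by
  apply (ha.mul hb).mul_right_cancel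
  calc b * b * (a * b) = b * (b * a * b) := by simp only [mul_assoc]
    _ = b * (a * b * a) := by rw [hbraid]
    _ = b * a * b * a := by simp only [mul_assoc]
    _ = a * b * a * a := by rw [hbraid]
    _ = a * b * (a * a) := by simp only [mul_assoc]
    _ = 1 * (a * b) := by rw [haa, mul_one, one_mul]

/-- A real `3 × 3` matrix commuting with a nonzero skew-symmetric matrix is a quadratic
polynomial in it. -/
lemma exists_quadratic_of_commute_skew {B J : Matrix (Fin 3) (Fin 3) ℝ} (hJ : Jᵀ = -J)
    (hJ0 : J ≠ 0) (hB : B * J = J * B) :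
    ∃ a b c : ℝ, B = a • (1 : Matrix (Fin 3) (Fin 3) ℝ) + b • J + c • (J * J) := by
  obtain ⟨x, y, z, rfl⟩ : ∃ x y z : ℝ, J = !![0, -z, y; z, 0, -x; -y, x, 0] := by
    refine ⟨J 2 1, J 0 2, J 1 0, ?_⟩
    have h : ∀ i j, J j i = -J i j := fun i j => congrFun (congrFun hJ i) j
    ext i j
    have h00 := h 0 0
    have h11 := h 1 1
    have h22 := h 2 2
    fin_cases i <;> fin_cases j <;> simp <;> linarith [h 0 1, h 0 2, h 1 2]
  have hN : x ^ 2 + y ^ 2 + z ^ 2 ≠ 0 := by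
    intro h
    have hx : x = 0 := by nlinarith [sq_nonneg x, sq_nonneg y, sq_nonneg z]
    have hy : y = 0 := by nlinarith [sq_nonneg x, sq_nonneg y, sq_nonneg z]
    have hz : z = 0 := by nlinarith [sq_nonneg x, sq_nonneg y, sq_nonneg z]
    apply hJ0
    ext i j
    fin_cases i <;> fin_cases j <;> simp [hx, hy, hz]
  have e : ∀ i j, (B * !![0, -z, y; z, 0, -x; -y, x, 0]) i j =
      (!![0, -z, y; z, 0, -x; -y, x, 0] * B) i j := fun i j => by rw [hB]
  have e00 := e 0 0
  have e01 := e 0 1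
  have e02 := e 0 2
  have e10 := e 1 0
  have e11 := e 1 1
  have e12 := e 1 2
  have e20 := e 2 0
  have e21 := e 2 1
  have e22 := e 2 2
  simp [Matrix.mul_apply, Fin.sum_univ_three] at e00 e01 e02 e10 e11 e12 e20 e21 e22
  set N := x ^ 2 + y ^ 2 + z ^ 2
  let t := B 0 0 + B 1 1 + B 2 2
  let q := x * (B 0 0 * x + B 0 1 * y + B 0 2 * z) + y * (B 1 0 * x + B 1 1 * y + B 1 2 * z)
    + z * (B 2 0 * x + B 2 1 * y + B 2 2 * z)
  let p := x * (B 2 1 - B 1 2) + y * (B 0 2 - B 2 0) + z * (B 1 0 - B 0 1)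
  refine ⟨q / N, p / (2 * N), (3 * q - t * N) / (2 * N ^ 2), ?_⟩
  ext i j
  fin_cases i <;> fin_cases j <;>
    simp [t, p, q] <;> field_simp <;> simp only [N] <;>
    clear hB hJ hJ0 hN t p q e N <;> grind

/-- The commutant of a nonzero skew-symmetric real `3 × 3` matrix is commutative. -/
lemma commute_of_commute_skew {B C J : Matrix (Fin 3) (Fin 3) ℝ} (hJ : Jᵀ = -J)
    (hJ0 : J ≠ 0) (hB : B * J = J * B) (hC : C * J = J * C) : B * C = C * B := by
  obtain ⟨a, b, c, rfl⟩ := exists_quadratic_of_commute_skew hJ hJ0 hB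
  have hJJ : Commute (J * J) C := by
    show J * J * C = C * (J * J)
    rw [mul_assoc, ← hC, ← mul_assoc, ← hC, mul_assoc]
  exact (((Commute.one_left C).smul_left a).add_left
    ((show Commute J C from hC.symm).smul_left b)).add_left (hJJ.smul_left c)

/-- Two orthogonal matrices of size three commuting with an orthogonal matrix that is not an
involution commute with each other. -/
lemma commute_of_commute_orthogonal {A B C : Matrix (Fin 3) (Fin 3) ℝ} (hA : Aᵀ * A = 1)
    (hAA : A * A ≠ 1) (hB : A * B = B * A) (hC : A * C = C * A) : B * C = C * B := by
  have hA' : A * Aᵀ = 1 := mul_eq_one_comm.mp hA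
  have key : ∀ D, A * D = D * A → D * (A - Aᵀ) = (A - Aᵀ) * D := by
    intro D hD
    have h : Aᵀ * D = D * Aᵀ := by
      calc Aᵀ * D = Aᵀ * (D * A) * Aᵀ := by rw [mul_assoc, mul_assoc, hA', mul_one]
        _ = Aᵀ * A * D * Aᵀ := by rw [← hD]; simp only [mul_assoc]
        _ = D * Aᵀ := by rw [hA, one_mul]
    rw [mul_sub, sub_mul, hD, h]
  refine commute_of_commute_skew (by simp) ?_ (key B hB) (key C hC)
  intro h
  rw [sub_eq_zero] at h
  exact hAA (by nth_rewrite 1 [h]; exact hA)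

/-- A symmetric real matrix with a vanishing square is zero. -/
lemma eq_zero_of_symm_of_trace_sq {A : Matrix (Fin 3) (Fin 3) ℝ} (hs : Aᵀ = A)
    (h : (A * A).trace = 0) : A = 0 := by
  apply Matrix.trace_conjTranspose_mul_self_eq_zero_iff.mp
  rwa [Matrix.conjTranspose_eq_transpose_of_trivial, hs]

/-- Rank-one orthogonal projections of `ℝ³`, described by algebraic identities. -/
structure IsLineProj (P : Matrix (Fin 3) (Fin 3) ℝ) : Prop where
  symm : Pᵀ = P
  idem : P * P = P
  trace : P.trace = 1
  sandwich : ∀ X, P * X * P = (P * X).trace • P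

/-- If the adjugate of a `3 × 3` matrix vanishes, so do all its `2 × 2` minors. -/
lemma mul_eq_mul_of_adjugate_eq_zero {P : Matrix (Fin 3) (Fin 3) ℝ} (h : P.adjugate = 0)
    (i j k l : Fin 3) : P i k * P j l = P i l * P j k := by
  rw [Matrix.adjugate_fin_three] at h
  have e := fun i j => congrFun (congrFun h i) j
  have e00 := e 0 0
  have e01 := e 0 1
  have e02 := e 0 2
  have e10 := e 1 0
  have e11 := e 1 1
  have e12 := e 1 2
  have e20 := e 2 0
  have e21 := e 2 1
  have e22 := e 2 2
  simp at e00 e01 e02 e10 e11 e12 e20 e21 e22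
  fin_cases i <;> fin_cases j <;> fin_cases k <;> fin_cases l <;> simp <;> linarith

/-- An involution in `SO(3)` other than the identity is the half-turn about a line. -/
lemma exists_isLineProj {A : Matrix (Fin 3) (Fin 3) ℝ} (hA : Aᵀ * A = 1) (hdet : A.det = 1)
    (hAA : A * A = 1) (hne : A ≠ 1) : ∃ P, IsLineProj P ∧ A = (2 : ℝ) • P - 1 := by
  have hs : Aᵀ = A := by
    calc Aᵀ = Aᵀ * (A * A) := by rw [hAA, mul_one]
      _ = A := by rw [← mul_assoc, hA, one_mul]
  have hadj : A.adjugate = A := by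
    calc A.adjugate = A.adjugate * A * A := by rw [mul_assoc, hAA, mul_one]
      _ = A := by rw [Matrix.adjugate_mul, hdet, one_smul, one_mul]
  have htr : A.trace = -1 := by
    have h1 : A.trace ^ 2 - 2 * A.trace - 3 = 0 := by
      have h2 := congrArg Matrix.trace hAA
      have h3 := congrArg Matrix.trace hadj
      rw [Matrix.adjugate_fin_three] at h3
      simp [Matrix.trace_fin_three, Matrix.mul_apply, Fin.sum_univ_three] at h2 h3 ⊢
      linear_combination h2 + 2 * h3
    have h4 : A.trace ≠ 3 := by
      intro h3
      refine hne (sub_eq_zero.mp (eq_zero_of_symm_of_trace_sq (by simp [hs]) ?_))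
      rw [sub_mul, mul_sub, hAA]
      simp [h3]
    have h5 : (A.trace - 3) * (A.trace + 1) = 0 := by linear_combination h1
    linarith [(mul_eq_zero.mp h5).resolve_left (sub_ne_zero.mpr h4)]
  obtain ⟨P, rfl⟩ : ∃ P, A = (2 : ℝ) • P - 1 := ⟨(1 / 2 : ℝ) • (A + 1), by module⟩
  refine ⟨P, ?_, rfl⟩
  have hPs : Pᵀ = P := by
    simp only [transpose_sub, transpose_smul, transpose_one, sub_left_inj] at hs
    exact smul_right_injective _ (two_ne_zero' ℝ) hs
  have hPtr : P.trace = 1 := by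
    simp at htr
    linarith
  have hPadj : P.adjugate = 0 := by
    rw [Matrix.adjugate_fin_three] at hadj ⊢
    have e := fun i j => congrFun (congrFun hadj i) j
    rw [Matrix.trace_fin_three] at hPtr
    have e00 := e 0 0
    have e01 := e 0 1
    have e02 := e 0 2
    have e10 := e 1 0
    have e11 := e 1 1
    have e12 := e 1 2
    have e20 := e 2 0
    have e21 := e 2 1
    have e22 := e 2 2
    simp at e00 e01 e02 e10 e11 e12 e20 e21 e22
    ext i j
    fin_cases i <;> fin_cases j <;> simp <;> linarith
  refine ⟨hPs, ?_, hPtr, ?_⟩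
  · have h4 : (4 : ℝ) • (P * P - P) = 0 := by
      rw [← sub_eq_zero] at hAA
      rw [← hAA]
      simp only [sub_mul, mul_sub, smul_mul_assoc, mul_smul_comm, one_mul, mul_one]
      module
    exact sub_eq_zero.mp ((smul_eq_zero.mp h4).resolve_left (by norm_num))
  · intro X
    ext i j
    simp only [Matrix.smul_apply, Matrix.trace, Matrix.diag, Matrix.mul_apply, smul_eq_mul,
      Finset.sum_mul]
    refine Finset.sum_congr rfl fun b _ => Finset.sum_congr rfl fun a _ => ?_
    linear_combination X a b * mul_eq_mul_of_adjugate_eq_zero hPadj i b a j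

/-- Distinct half-turns satisfying the braid relation have axes at angle `π / 3`. -/
lemma trace_mul_of_braid {P Q : Matrix (Fin 3) (Fin 3) ℝ} (hP : IsLineProj P)
    (hQ : IsLineProj Q) (hne : P ≠ Q)
    (h : ((2 : ℝ) • P - 1) * ((2 : ℝ) • Q - 1) * ((2 : ℝ) • P - 1) =
      ((2 : ℝ) • Q - 1) * ((2 : ℝ) • P - 1) * ((2 : ℝ) • Q - 1)) :
    (P * Q).trace = 1 / 4 := by
  have hPQP := hP.sandwich Q
  have hQPQ := hQ.sandwich P
  rw [Matrix.trace_mul_comm] at hQPQ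
  set t := (P * Q).trace
  have expand : ∀ R S : Matrix (Fin 3) (Fin 3) ℝ, R * R = R →
      ((2 : ℝ) • R - 1) * ((2 : ℝ) • S - 1) * ((2 : ℝ) • R - 1) =
        (8 : ℝ) • (R * S * R) - (4 : ℝ) • (R * S) - (4 : ℝ) • (S * R) + (2 : ℝ) • S - 1 := by
    intro R S hR
    simp only [sub_mul, mul_sub, smul_mul_assoc, mul_smul_comm, one_mul, mul_one, hR]
    module
  rw [expand P Q hP.idem, expand Q P hQ.idem, hPQP, hQPQ] at h
  have hz : (8 * t - 2) • (P - Q) = 0 := by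
    rw [← sub_eq_zero] at h
    rw [← h]
    module
  rcases smul_eq_zero.mp hz with h | h
  · linarith
  · exact absurd (sub_eq_zero.mp h) hne

/-- Distinct commuting half-turns have perpendicular axes. -/
lemma mul_eq_zero_of_commute {P Q : Matrix (Fin 3) (Fin 3) ℝ} (hP : IsLineProj P)
    (hQ : IsLineProj Q) (hne : P ≠ Q)
    (h : ((2 : ℝ) • P - 1) * ((2 : ℝ) • Q - 1) = ((2 : ℝ) • Q - 1) * ((2 : ℝ) • P - 1)) :
    P * Q = 0 := by
  have hPQ : P * Q = Q * P := by
    have h4 : (4 : ℝ) • (P * Q - Q * P) = 0 := by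
      rw [← sub_eq_zero] at h
      rw [← h]
      simp only [sub_mul, mul_sub, smul_mul_assoc, mul_smul_comm, one_mul, mul_one]
      module
    exact sub_eq_zero.mp ((smul_eq_zero.mp h4).resolve_left (by norm_num))
  have hPQP : P * Q = (P * Q).trace • P := by
    rw [← hP.sandwich, mul_assoc, ← hPQ, ← mul_assoc, hP.idem]
  have hQPQ : P * Q = (P * Q).trace • Q := by
    rw [Matrix.trace_mul_comm, ← hQ.sandwich, mul_assoc, hPQ, ← mul_assoc, hQ.idem]
  have hz : (P * Q).trace • (P - Q) = 0 := by rw [smul_sub, ← hPQP, ← hQPQ, sub_self]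
  rw [hPQP, (smul_eq_zero.mp hz).resolve_right (sub_ne_zero.mpr hne), zero_smul]

/-- Three mutually perpendicular lines resolve the identity. -/
lemma sum_isLineProj_eq_one {P Q R : Matrix (Fin 3) (Fin 3) ℝ} (hP : IsLineProj P)
    (hQ : IsLineProj Q) (hR : IsLineProj R) (hPQ : P * Q = 0) (hPR : P * R = 0)
    (hQR : Q * R = 0) : P + Q + R = 1 := by
  have swap : ∀ {S T : Matrix (Fin 3) (Fin 3) ℝ}, IsLineProj S → IsLineProj T → S * T = 0 →
      T * S = 0 := fun {S T} hS hT h => by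
    rw [← hS.symm, ← hT.symm, ← Matrix.transpose_mul, h, Matrix.transpose_zero]
  have hQP := swap hP hQ hPQ
  have hRP := swap hP hR hPR
  have hRQ := swap hQ hR hQR
  refine sub_eq_zero.mp (eq_zero_of_symm_of_trace_sq ?_ ?_)
  · simp [hP.symm, hQ.symm, hR.symm]
  · have : (P + Q + R - 1) * (P + Q + R - 1) = 1 - P - Q - R := by
      simp only [sub_mul, mul_sub, add_mul, mul_add, one_mul, mul_one, hP.idem, hQ.idem, hR.idem,
        hPQ, hPR, hQR, hQP, hRP, hRQ]
      abel
    rw [this]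
    simp [hP.trace, hQ.trace, hR.trace]
    norm_num

/-- Among five elements of `SO(3)` satisfying the braid relations, two neighbours coincide. -/
lemma exists_neighbours_eq {g : ℕ → Matrix (Fin 3) (Fin 3) ℝ}
    (hSO : ∀ i < 5, (g i)ᵀ * g i = 1 ∧ (g i).det = 1)
    (hfar : ∀ i j, i + 2 ≤ j → j < 5 → g i * g j = g j * g i)
    (hbraid : ∀ i, i + 1 < 5 → g i * g (i + 1) * g i = g (i + 1) * g i * g (i + 1)) :
    ∃ k, k + 1 < 5 ∧ g k = g (k + 1) := by
  have hunit : ∀ i < 5, IsUnit (g i) := fun i hi =>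
    IsUnit.of_mul_eq_one _ (mul_eq_one_comm.mp (hSO i hi).1)
  have eq_of_commute : ∀ k, k + 1 < 5 → g k * g (k + 1) = g (k + 1) * g k → g k = g (k + 1) :=
    fun k hk h => eq_of_commute_of_braid (hunit k (by omega)) (hunit _ hk) h (hbraid k hk)
  by_contra! hne
  have hncomm : ∀ k, k + 1 < 5 → g k * g (k + 1) ≠ g (k + 1) * g k :=
    fun k hk h => hne k hk (eq_of_commute k hk h)
  have h0 : g 0 * g 0 = 1 := by
    by_contra h
    exact hncomm 2 (by norm_num) (commute_of_commute_orthogonal (hSO 0 (by norm_num)).1 h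
      (hfar 0 2 (by norm_num) (by norm_num)) (hfar 0 3 (by norm_num) (by norm_num)))
  have hsq : ∀ i < 5, g i * g i = 1 := by
    intro i hi
    induction i with
    | zero => exact h0
    | succ i ih =>
      exact sq_eq_one_of_braid (hunit i (by omega)) (hunit _ hi) (hbraid i hi) (ih (by omega))
  have hone : ∀ i < 5, g i ≠ 1 := by
    intro i hi h
    rcases i with _ | i
    · exact hncomm 0 (by norm_num) (by rw [h, one_mul, mul_one])
    · exact hncomm i hi (by rw [h, one_mul, mul_one])
  choose! P hP hgP using fun i (hi : i < 5) =>
    exists_isLineProj (hSO i hi).1 (hSO i hi).2 (hsq i hi) (hone i hi)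
  have horth : ∀ i j, i + 2 ≤ j → j < 5 → g i ≠ g j → P i * P j = 0 := by
    intro i j hij hj hij'
    refine mul_eq_zero_of_commute (hP i (by omega)) (hP j hj) ?_ ?_
    · intro h
      exact hij' (by rw [hgP i (by omega), hgP j hj, h])
    · rw [← hgP i (by omega), ← hgP j hj]
      exact hfar i j hij hj
  have hadj : ∀ i, i + 1 < 5 → (P i * P (i + 1)).trace = 1 / 4 := by
    intro i hi
    refine trace_mul_of_braid (hP i (by omega)) (hP _ hi) ?_ ?_
    · intro h
      exact hne i hi (by rw [hgP i (by omega), hgP _ hi, h])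
    · rw [← hgP i (by omega), ← hgP _ hi]
      exact hbraid i hi
  have h02 : P 0 * P 2 = 0 := horth 0 2 (by norm_num) (by norm_num) fun h =>
    hncomm 2 (by norm_num) (h ▸ hfar 0 3 (by norm_num) (by norm_num))
  have h03 : P 0 * P 3 = 0 := horth 0 3 (by norm_num) (by norm_num) fun h =>
    hncomm 2 (by norm_num) (h ▸ hfar 0 2 (by norm_num) (by norm_num)).symm
  have h04 : P 0 * P 4 = 0 := horth 0 4 (by norm_num) (by norm_num) fun h =>
    hncomm 3 (by norm_num) (h ▸ hfar 0 3 (by norm_num) (by norm_num)).symm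
  have h24 : P 2 * P 4 = 0 := horth 2 4 (by norm_num) (by norm_num) fun h =>
    hncomm 1 (by norm_num) (h ▸ hfar 1 4 (by norm_num) (by norm_num))
  have hsum := sum_isLineProj_eq_one (hP 0 (by norm_num)) (hP 2 (by norm_num))
    (hP 4 (by norm_num)) h02 h04 h24
  have htr : ((P 0 + P 2 + P 4) * P 3).trace = 1 := by
    rw [hsum, one_mul, (hP 3 (by norm_num)).trace]
  rw [add_mul, add_mul, Matrix.trace_add, Matrix.trace_add, h03, Matrix.trace_zero,
    hadj 2 (by norm_num), Matrix.trace_mul_comm, hadj 3 (by norm_num)] at htr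
  norm_num at htr

end BraidSO3

/-- Let `n ≥ 6` and let `g 0, …, g (n-2)` be elements of `SO(3)` (corresponding to
`σ₁, …, σ_{n-1}`) satisfying the braid relations: `g i` and `g j` commute whenever
`|i − j| ≥ 2`, and `g i * g (i+1) * g i = g (i+1) * g i * g (i+1)` for consecutive indices.
Then all the `g i` are equal.  (Consequently every homomorphism from Artin's braid group
`B_n` to `SO(3)` factors through the abelianization `ℤ` of `B_n`.) -/
theorem braid_relations_in_SO3_all_equal
    (n : ℕ) (hn : 6 ≤ n) (g : ℕ → Matrix (Fin 3) (Fin 3) ℝ)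
    (hSO : ∀ i, i < n - 1 → (g i)ᵀ * g i = 1 ∧ (g i).det = 1)
    (hfar : ∀ i j, i < n - 1 → j < n - 1 → 2 ≤ ((i : ℤ) - (j : ℤ)).natAbs →
      g i * g j = g j * g i)
    (hbraid : ∀ i, i + 1 < n - 1 →
      g i * g (i + 1) * g i = g (i + 1) * g i * g (i + 1)) :
    ∀ i j, i < n - 1 → j < n - 1 → g i = g j := by
  have hunit : ∀ i < n - 1, IsUnit (g i) := fun i hi =>
    IsUnit.of_mul_eq_one _ (mul_eq_one_comm.mp (hSO i hi).1)
  have hfar' : ∀ i j, i + 2 ≤ j → j < n - 1 → g i * g j = g j * g i := fun i j hij hj =>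
    hfar i j (by omega) hj (by omega)
  obtain ⟨k, hk, heq⟩ := BraidSO3.exists_neighbours_eq (fun i hi => hSO i (by omega))
    (fun i j hij hj => hfar' i j hij (by omega)) (fun i hi => hbraid i (by omega))
  have h := BraidSO3.braid_sequence_eq hunit hfar' hbraid (by omega : k + 1 < n - 1) heq
  intro i j hi hj
  rw [h i hi, h j hj]
end

section
/- The space of ordered non-commuting pairs in SU(2), that is, the subspace {(A, B) ∈ SU(2) × SU(2) | AB ≠ BA} of SU(2) × SU(2) with the subspace topology, is homotopy equivalent to the special orthogonal group SO(3). -/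
open Matrix

namespace NoncommutingPairs

/-- The quaternion with real part `a` and imaginary part `u`, as a complex `2 × 2` matrix. -/
def quaternionMatrix (a : ℝ) (u : Fin 3 → ℝ) : Matrix (Fin 2) (Fin 2) ℂ :=
  !![⟨a, u 0⟩, ⟨u 1, u 2⟩; ⟨-u 1, u 2⟩, ⟨a, -u 0⟩]

/-- The real part of a matrix seen as a quaternion. -/
def realPart (A : Matrix (Fin 2) (Fin 2) ℂ) : ℝ := (A 0 0).re

/-- The imaginary part of a matrix seen as a quaternion. -/
def imPart (A : Matrix (Fin 2) (Fin 2) ℂ) : Fin 3 → ℝ := ![(A 0 0).im, (A 0 1).re, (A 0 1).im]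

@[fun_prop]
lemma continuous_realPart : Continuous realPart := by
  unfold realPart; fun_prop

@[fun_prop]
lemma continuous_imPart : Continuous imPart := by
  unfold imPart
  refine continuous_pi fun i => ?_
  fin_cases i <;> simp <;> fun_prop

@[simp]
lemma realPart_quaternionMatrix (a : ℝ) (u : Fin 3 → ℝ) :
    realPart (quaternionMatrix a u) = a := by
  simp [realPart, quaternionMatrix]

@[simp]
lemma imPart_quaternionMatrix (a : ℝ) (u : Fin 3 → ℝ) :
    imPart (quaternionMatrix a u) = u := by
  ext i
  fin_cases i <;> simp [imPart, quaternionMatrix]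

lemma quaternionMatrix_mem {a : ℝ} {u : Fin 3 → ℝ} (h : a ^ 2 + u ⬝ᵥ u = 1) :
    quaternionMatrix a u ∈ specialUnitaryGroup (Fin 2) ℂ := by
  simp only [dotProduct, Fin.sum_univ_three] at h
  rw [mem_specialUnitaryGroup_iff, mem_unitaryGroup_iff]
  constructor
  · ext i j
    fin_cases i <;> fin_cases j <;>
      simp [quaternionMatrix, Matrix.mul_apply, Fin.sum_univ_two, star_apply, Complex.ext_iff] <;>
      constructor <;> linarith
  · rw [det_fin_two]
    simp [quaternionMatrix, Complex.ext_iff]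
    constructor <;> linarith

lemma quaternionMatrix_realPart_imPart {A : Matrix (Fin 2) (Fin 2) ℂ}
    (h : A ∈ specialUnitaryGroup (Fin 2) ℂ) : quaternionMatrix (realPart A) (imPart A) = A := by
  rw [mem_specialUnitaryGroup_iff, mem_unitaryGroup_iff] at h
  obtain ⟨hu, hd⟩ := h
  have key : star A = adjugate A := by
    have h1 : adjugate A * A = 1 := by rw [adjugate_mul, hd, one_smul]
    exact (left_inv_eq_right_inv h1 hu).symm
  rw [adjugate_fin_two] at key
  have h11 := congrFun (congrFun key 0) 0
  have h10 := congrFun (congrFun key 0) 1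
  simp [star_apply, Complex.ext_iff] at h11 h10
  ext i j
  fin_cases i <;> fin_cases j <;>
    simp [quaternionMatrix, realPart, imPart, Complex.ext_iff] <;>
    constructor <;> linarith

lemma realPart_sq_add_imPart_dot {A : Matrix (Fin 2) (Fin 2) ℂ}
    (h : A ∈ specialUnitaryGroup (Fin 2) ℂ) :
    realPart A ^ 2 + imPart A ⬝ᵥ imPart A = 1 := by
  have hA := quaternionMatrix_realPart_imPart h
  have hd := (mem_specialUnitaryGroup_iff.mp h).2
  rw [← hA, det_fin_two] at hd
  have := congrArg Complex.re hd
  simp [quaternionMatrix] at this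
  simp only [dotProduct, Fin.sum_univ_three]
  linarith

lemma quaternionMatrix_commute_iff (a b : ℝ) (u v : Fin 3 → ℝ) :
    quaternionMatrix a u * quaternionMatrix b v = quaternionMatrix b v * quaternionMatrix a u ↔
      crossProduct u v = 0 := by
  constructor
  · intro h
    have h00 := congrFun (congrFun h 0) 0
    have h01 := congrFun (congrFun h 0) 1
    simp [quaternionMatrix, Matrix.mul_apply, Fin.sum_univ_two, Complex.ext_iff] at h00 h01
    obtain ⟨h1, h2⟩ := h00
    obtain ⟨h3, h4⟩ := h01
    rw [cross_apply]
    ext i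
    fin_cases i <;> simp <;> linarith
  · intro h
    rw [cross_apply] at h
    have h0 := congrFun h 0
    have h1 := congrFun h 1
    have h2 := congrFun h 2
    simp at h0 h1 h2
    ext i j
    fin_cases i <;> fin_cases j <;>
      simp [quaternionMatrix, Matrix.mul_apply, Fin.sum_univ_two, Complex.ext_iff] <;>
      constructor <;> linarith

/-- The unit quaternion in the direction of `a + u`, as a matrix. -/
noncomputable def unitQuaternionMatrix (a : ℝ) (u : Fin 3 → ℝ) : Matrix (Fin 2) (Fin 2) ℂ :=
  quaternionMatrix ((√(a ^ 2 + u ⬝ᵥ u))⁻¹ * a) ((√(a ^ 2 + u ⬝ᵥ u))⁻¹ • u)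

lemma dotProduct_self_pos {u : Fin 3 → ℝ} (hu : u ≠ 0) : 0 < u ⬝ᵥ u := by
  simpa using dotProduct_star_self_pos_iff.mpr hu

lemma sq_add_dotProduct_pos (a : ℝ) {u : Fin 3 → ℝ} (hu : u ≠ 0) : 0 < a ^ 2 + u ⬝ᵥ u := by
  have := dotProduct_self_pos hu
  positivity

lemma unitQuaternionMatrix_mem (a : ℝ) {u : Fin 3 → ℝ} (hu : u ≠ 0) :
    unitQuaternionMatrix a u ∈ specialUnitaryGroup (Fin 2) ℂ := by
  have h := sq_add_dotProduct_pos a hu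
  apply quaternionMatrix_mem
  rw [smul_dotProduct, dotProduct_smul, smul_eq_mul, smul_eq_mul, mul_pow, ← mul_assoc,
    ← pow_two, ← mul_add, inv_pow, Real.sq_sqrt h.le, inv_mul_cancel₀ h.ne']

lemma unitQuaternionMatrix_of_eq_one {a : ℝ} {u : Fin 3 → ℝ} (h : a ^ 2 + u ⬝ᵥ u = 1) :
    unitQuaternionMatrix a u = quaternionMatrix a u := by
  simp [unitQuaternionMatrix, h]

lemma continuous_unitQuaternionMatrix {X : Type*} [TopologicalSpace X] {a : X → ℝ}
    {u : X → Fin 3 → ℝ} (ha : Continuous a) (hu : Continuous u) (h : ∀ x, u x ≠ 0) :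
    Continuous fun x => unitQuaternionMatrix (a x) (u x) := by
  have hN : Continuous fun x => (√(a x ^ 2 + u x ⬝ᵥ u x))⁻¹ := by
    refine Continuous.inv₀ ((ha.pow 2).add (hu.dotProduct hu)).sqrt fun x => ?_
    exact (Real.sqrt_pos.mpr (sq_add_dotProduct_pos (a x) (h x))).ne'
  have hM : Continuous fun p : ℝ × (Fin 3 → ℝ) => quaternionMatrix p.1 p.2 := by
    unfold quaternionMatrix
    simp only [Complex.mk_eq_add_mul_I]
    refine continuous_matrix fun i j => ?_
    fin_cases i <;> fin_cases j <;> simp <;> fun_prop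
  exact hM.comp ((hN.mul ha).prodMk (hN.smul hu))

lemma left_ne_zero_of_cross {u v : Fin 3 → ℝ} (h : crossProduct u v ≠ 0) : u ≠ 0 := by
  rintro rfl; simp at h

lemma right_ne_zero_of_cross {u v : Fin 3 → ℝ} (h : crossProduct u v ≠ 0) : v ≠ 0 := by
  rintro rfl; simp at h

/-- The space of ordered non-commuting pairs in `SU(2)`. -/
abbrev Pairs : Type :=
  {p : (Matrix (Fin 2) (Fin 2) ℂ) × (Matrix (Fin 2) (Fin 2) ℂ) //
    p.1 ∈ Matrix.specialUnitaryGroup (Fin 2) ℂ ∧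
    p.2 ∈ Matrix.specialUnitaryGroup (Fin 2) ℂ ∧
    p.1 * p.2 ≠ p.2 * p.1}

/-- The special orthogonal group `SO(3)`. -/
abbrev Rotations : Type := {A : Matrix (Fin 3) (Fin 3) ℝ // Aᵀ * A = 1 ∧ A.det = 1}

/-- The pair of unit quaternions in the directions of `a + u` and `b + v`. -/
noncomputable def unitPair (a b : ℝ) (u v : Fin 3 → ℝ) (h : crossProduct u v ≠ 0) : Pairs :=
  ⟨(unitQuaternionMatrix a u, unitQuaternionMatrix b v),
    unitQuaternionMatrix_mem a (left_ne_zero_of_cross h),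
    unitQuaternionMatrix_mem b (right_ne_zero_of_cross h), by
      have h1 := Real.sqrt_pos.mpr (sq_add_dotProduct_pos a (left_ne_zero_of_cross h))
      have h2 := Real.sqrt_pos.mpr (sq_add_dotProduct_pos b (right_ne_zero_of_cross h))
      rw [unitQuaternionMatrix, unitQuaternionMatrix, Ne, quaternionMatrix_commute_iff]
      simp [h, h1.ne', h2.ne']⟩

lemma continuous_unitPair {X : Type*} [TopologicalSpace X] {a b : X → ℝ}
    {u v : X → Fin 3 → ℝ} (ha : Continuous a) (hb : Continuous b) (hu : Continuous u)
    (hv : Continuous v) (h : ∀ x, crossProduct (u x) (v x) ≠ 0) :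
    Continuous fun x => unitPair (a x) (b x) (u x) (v x) (h x) :=
  ((continuous_unitQuaternionMatrix ha hu fun x => left_ne_zero_of_cross (h x)).prodMk
    (continuous_unitQuaternionMatrix hb hv fun x => right_ne_zero_of_cross (h x))).subtype_mk _

lemma cross_imPart_ne_zero (p : Pairs) : crossProduct (imPart p.1.1) (imPart p.1.2) ≠ 0 := by
  obtain ⟨⟨A, B⟩, hA, hB, hAB⟩ := p
  rw [Ne, ← quaternionMatrix_commute_iff (realPart A) (realPart B)]
  rwa [quaternionMatrix_realPart_imPart hA, quaternionMatrix_realPart_imPart hB]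

lemma unitPair_parts (p : Pairs) :
    unitPair (realPart p.1.1) (realPart p.1.2) (imPart p.1.1) (imPart p.1.2)
      (cross_imPart_ne_zero p) = p := by
  obtain ⟨⟨A, B⟩, hA, hB, hAB⟩ := p
  apply Subtype.ext
  simp only [unitPair]
  rw [unitQuaternionMatrix_of_eq_one (realPart_sq_add_imPart_dot hA),
    unitQuaternionMatrix_of_eq_one (realPart_sq_add_imPart_dot hB),
    quaternionMatrix_realPart_imPart hA, quaternionMatrix_realPart_imPart hB]

/-- The component of `v` orthogonal to `u`, scaled by `u ⬝ᵥ u`. -/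
def orthogonalPart (u v : Fin 3 → ℝ) : Fin 3 → ℝ := (u ⬝ᵥ u) • v - (u ⬝ᵥ v) • u

lemma cross_orthogonalPart (u v : Fin 3 → ℝ) :
    crossProduct u (orthogonalPart u v) = (u ⬝ᵥ u) • crossProduct u v := by
  simp [orthogonalPart]

lemma dotProduct_orthogonalPart (u v : Fin 3 → ℝ) : u ⬝ᵥ orthogonalPart u v = 0 := by
  simp [orthogonalPart, dotProduct_sub, mul_comm]

lemma orthogonalPart_ne_zero {u v : Fin 3 → ℝ} (h : crossProduct u v ≠ 0) :
    orthogonalPart u v ≠ 0 := by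
  apply right_ne_zero_of_cross (u := u)
  rw [cross_orthogonalPart]
  exact smul_ne_zero (dotProduct_self_pos (left_ne_zero_of_cross h)).ne' h

/-- The unit vector in the direction of `u`. -/
noncomputable def unitVector (u : Fin 3 → ℝ) : Fin 3 → ℝ := (√(u ⬝ᵥ u))⁻¹ • u

lemma unitVector_dotProduct_self {u : Fin 3 → ℝ} (hu : u ≠ 0) :
    unitVector u ⬝ᵥ unitVector u = 1 := by
  have h := dotProduct_self_pos hu
  rw [unitVector, smul_dotProduct, dotProduct_smul, smul_eq_mul, smul_eq_mul, ← mul_assoc,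
    ← pow_two, inv_pow, Real.sq_sqrt h.le, inv_mul_cancel₀ h.ne']

lemma unitVector_of_eq_one {u : Fin 3 → ℝ} (h : u ⬝ᵥ u = 1) : unitVector u = u := by
  simp [unitVector, h]

lemma continuous_unitVector {X : Type*} [TopologicalSpace X] {u : X → Fin 3 → ℝ}
    (hu : Continuous u) (h : ∀ x, u x ≠ 0) : Continuous fun x => unitVector (u x) := by
  refine Continuous.smul (Continuous.inv₀ (hu.dotProduct hu).sqrt fun x => ?_) hu
  exact (Real.sqrt_pos.mpr (dotProduct_self_pos (h x))).ne'

/-- The rotation whose first two rows are a given orthonormal pair. -/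
def rotationOfRows (e f : Fin 3 → ℝ) (he : e ⬝ᵥ e = 1) (hf : f ⬝ᵥ f = 1) (hef : e ⬝ᵥ f = 0) :
    Rotations :=
  ⟨of ![e, f, crossProduct e f], by
    have hc : crossProduct e f ⬝ᵥ crossProduct e f = 1 := by
      rw [cross_dot_cross, he, hf, hef, dotProduct_comm f e, hef]; norm_num
    constructor
    · rw [mul_eq_one_comm]
      ext i j
      change ![e, f, crossProduct e f] i ⬝ᵥ ![e, f, crossProduct e f] j = _
      fin_cases i <;> fin_cases j <;>
        simp [he, hf, hef, hc, dotProduct_comm f e, dotProduct_comm (crossProduct e f)]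
    · rw [det_fin_three]
      simp [cross_apply, dotProduct, Fin.sum_univ_three] at hc ⊢
      linarith⟩

/-- The first two rows of a rotation are orthonormal, and the third is their cross product. -/
lemma rotation_rows (A : Rotations) :
    A.1 0 ⬝ᵥ A.1 0 = 1 ∧ A.1 1 ⬝ᵥ A.1 1 = 1 ∧ A.1 0 ⬝ᵥ A.1 1 = 0 ∧
      crossProduct (A.1 0) (A.1 1) = A.1 2 := by
  obtain ⟨A, h, hd⟩ := A
  have h' : A * Aᵀ = 1 := mul_eq_one_comm.mp h
  refine ⟨congrFun (congrFun h' 0) 0, congrFun (congrFun h' 1) 1, congrFun (congrFun h' 0) 1, ?_⟩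
  have key : Aᵀ = adjugate A := by
    have h1 : adjugate A * A = 1 := by rw [adjugate_mul, hd, one_smul]
    exact (left_inv_eq_right_inv h1 h').symm
  rw [adjugate_fin_three] at key
  have k (i : Fin 3) := congrFun (congrFun key i) 2
  have k0 := k 0
  have k1 := k 1
  have k2 := k 2
  simp at k0 k1 k2
  rw [cross_apply]
  ext i
  fin_cases i <;> simp <;> linarith

lemma cross_rows_ne_zero (A : Rotations) : crossProduct (A.1 0) (A.1 1) ≠ 0 := by
  obtain ⟨h0, h1, h01, -⟩ := rotation_rows A
  intro h
  have := cross_dot_cross (A.1 0) (A.1 1) (A.1 0) (A.1 1)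
  rw [h, h0, h1, h01] at this
  simp at this

/-- Gram–Schmidt orthonormalization of the imaginary parts. -/
noncomputable def toRotation : C(Pairs, Rotations) where
  toFun p := rotationOfRows (unitVector (imPart p.1.1))
    (unitVector (orthogonalPart (imPart p.1.1) (imPart p.1.2)))
    (unitVector_dotProduct_self (left_ne_zero_of_cross (cross_imPart_ne_zero p)))
    (unitVector_dotProduct_self (orthogonalPart_ne_zero (cross_imPart_ne_zero p)))
    (by simp [unitVector, dotProduct_orthogonalPart])
  continuous_toFun := by
    have hu : Continuous fun p : Pairs => imPart p.1.1 := by fun_prop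
    have hv : Continuous fun p : Pairs => imPart p.1.2 := by fun_prop
    have he := continuous_unitVector hu
      fun p => left_ne_zero_of_cross (cross_imPart_ne_zero p)
    have hf := continuous_unitVector
      (((hu.dotProduct hu).smul hv).sub ((hu.dotProduct hv).smul hu))
      fun p => orthogonalPart_ne_zero (cross_imPart_ne_zero p)
    refine Continuous.subtype_mk (continuous_pi fun i => ?_) _
    fin_cases i
    · exact he
    · exact hf
    · change Continuous fun p : Pairs => crossProduct (unitVector (imPart p.1.1))
        (unitVector (orthogonalPart (imPart p.1.1) (imPart p.1.2)))
      simp only [cross_apply]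
      have he' := continuous_pi_iff.mp he
      have hf' := continuous_pi_iff.mp hf
      refine continuous_pi fun j => ?_
      fin_cases j
      · exact ((he' 1).mul (hf' 2)).sub ((he' 2).mul (hf' 1))
      · exact ((he' 2).mul (hf' 0)).sub ((he' 0).mul (hf' 2))
      · exact ((he' 0).mul (hf' 1)).sub ((he' 1).mul (hf' 0))

/-- The pair of purely imaginary unit quaternions given by the first two rows. -/
noncomputable def ofRotation : C(Rotations, Pairs) where
  toFun A := unitPair 0 0 (A.1 0) (A.1 1) (cross_rows_ne_zero A)
  continuous_toFun := continuous_unitPair continuous_const continuous_const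
    (continuous_pi fun j => Continuous.matrix_elem continuous_subtype_val 0 j)
    (continuous_pi fun j => Continuous.matrix_elem continuous_subtype_val 1 j) _

lemma toRotation_ofRotation (A : Rotations) : toRotation (ofRotation A) = A := by
  obtain ⟨h0, h1, h01, h2⟩ := rotation_rows A
  have e0 : imPart (ofRotation A).1.1 = A.1 0 := by
    simp [ofRotation, unitPair, unitQuaternionMatrix, h0]
  have e1 : imPart (ofRotation A).1.2 = A.1 1 := by
    simp [ofRotation, unitPair, unitQuaternionMatrix, h1]
  have e2 : orthogonalPart (A.1 0) (A.1 1) = A.1 1 := by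
    simp [orthogonalPart, h0, h01]
  apply Subtype.ext
  simp only [toRotation, rotationOfRows, ContinuousMap.coe_mk, e0, e1, e2,
    unitVector_of_eq_one h0, unitVector_of_eq_one h1, h2]
  ext i j
  fin_cases i <;> rfl

lemma cross_interpolation_ne_zero {u v : Fin 3 → ℝ} (h : crossProduct u v ≠ 0) {t : ℝ}
    (h0 : 0 ≤ t) (h1 : t ≤ 1) :
    crossProduct ((1 - t) • unitVector u + t • u)
      ((1 - t) • unitVector (orthogonalPart u v) + t • v) ≠ 0 := by
  have hu := dotProduct_self_pos (left_ne_zero_of_cross h)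
  have hw := dotProduct_self_pos (orthogonalPart_ne_zero h)
  have e : crossProduct ((1 - t) • unitVector u + t • u)
      ((1 - t) • unitVector (orthogonalPart u v) + t • v) =
      (((1 - t) * (√(u ⬝ᵥ u))⁻¹ + t) *
        ((1 - t) * ((√(orthogonalPart u v ⬝ᵥ orthogonalPart u v))⁻¹ * (u ⬝ᵥ u)) + t)) •
        crossProduct u v := by
    simp only [unitVector, smul_smul, ← add_smul, map_smul, map_add, LinearMap.smul_apply,
      cross_orthogonalPart]
    congr 1
    ring
  have pos {c : ℝ} (hc : 0 < c) : 0 < (1 - t) * c + t := by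
    rcases h0.eq_or_lt with rfl | ht
    · simpa using hc
    · have := mul_nonneg (sub_nonneg.mpr h1) hc.le
      linarith
  rw [e]
  exact smul_ne_zero (mul_pos (pos (by positivity)) (pos (by positivity))).ne' h

/-- The normalized straight-line homotopy from `ofRotation ∘ toRotation` to the identity. -/
noncomputable def interpolation :
    (ofRotation.comp toRotation).Homotopy (ContinuousMap.id Pairs) where
  toFun x := unitPair (x.1 * realPart x.2.1.1) (x.1 * realPart x.2.1.2) _ _
    (cross_interpolation_ne_zero (cross_imPart_ne_zero x.2) x.1.2.1 x.1.2.2)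
  continuous_toFun := by
    have hu : Continuous fun x : unitInterval × Pairs => imPart x.2.1.1 := by fun_prop
    have hv : Continuous fun x : unitInterval × Pairs => imPart x.2.1.2 := by fun_prop
    have he := continuous_unitVector hu
      fun x => left_ne_zero_of_cross (cross_imPart_ne_zero x.2)
    have hf := continuous_unitVector
      (((hu.dotProduct hu).smul hv).sub ((hu.dotProduct hv).smul hu))
      fun x => orthogonalPart_ne_zero (cross_imPart_ne_zero x.2)
    have ht : Continuous fun x : unitInterval × Pairs => (x.1 : ℝ) := by fun_prop
    have hs : Continuous fun x : unitInterval × Pairs => 1 - (x.1 : ℝ) := by fun_prop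
    exact continuous_unitPair (by fun_prop) (by fun_prop) ((hs.smul he).add (ht.smul hu))
      ((hs.smul hf).add (ht.smul hv)) _
  map_zero_left p := by
    simp [ofRotation, toRotation, rotationOfRows]
    rfl
  map_one_left p := by
    simpa using unitPair_parts p

end NoncommutingPairs

/-- The space of ordered non-commuting pairs in `SU(2)`, that is, the subspace
`{(A, B) ∈ SU(2) × SU(2) | AB ≠ BA}` of `SU(2) × SU(2)`, is homotopy equivalent to the
special orthogonal group `SO(3)`. -/
theorem noncommuting_pairs_SU2_homotopyEquiv_SO3 :
    Nonempty (ContinuousMap.HomotopyEquiv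
      {p : (Matrix (Fin 2) (Fin 2) ℂ) × (Matrix (Fin 2) (Fin 2) ℂ) //
        p.1 ∈ Matrix.specialUnitaryGroup (Fin 2) ℂ ∧
        p.2 ∈ Matrix.specialUnitaryGroup (Fin 2) ℂ ∧
        p.1 * p.2 ≠ p.2 * p.1}
      {A : Matrix (Fin 3) (Fin 3) ℝ // Aᵀ * A = 1 ∧ A.det = 1}) := by
  exact ⟨{
    toFun := NoncommutingPairs.toRotation
    invFun := NoncommutingPairs.ofRotation
    left_inv := ⟨NoncommutingPairs.interpolation⟩
    right_inv := by
      rw [show NoncommutingPairs.toRotation.comp NoncommutingPairs.ofRotation =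
        ContinuousMap.id _ from ContinuousMap.ext NoncommutingPairs.toRotation_ofRotation] }⟩
end

section
/- Let A ∈ SU(2) with A ≠ I and A ≠ −I. Then the complement in SU(2) of the centralizer of A, i.e. the subspace {B ∈ SU(2) | AB ≠ BA}, is homotopy equivalent to the circle S¹. -/
open ComplexConjugate in
/-- The matrix with rows `(a, -conj b)` and `(b, conj a)`, the general form of an element of `SU(2)`
when `‖a‖ ^ 2 + ‖b‖ ^ 2 = 1`. -/
def su2Matrix (a b : ℂ) : Matrix (Fin 2) (Fin 2) ℂ := !![a, -conj b; b, conj a]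

theorem mem_specialUnitaryGroup_fin_two_iff (M : Matrix (Fin 2) (Fin 2) ℂ) :
    M ∈ Matrix.specialUnitaryGroup (Fin 2) ℂ ↔
      M = su2Matrix (M 0 0) (M 1 0) ∧ ‖M 0 0‖ ^ 2 + ‖M 1 0‖ ^ 2 = 1 := by
  constructor
  · intro h
    obtain ⟨hU, hdet⟩ := Matrix.mem_specialUnitaryGroup_iff.1 h
    have hstar : star M = M.adjugate := by
      have h1 := Matrix.mem_unitaryGroup_iff'.1 hU
      calc star M = star M * (M * M.adjugate) := by rw [Matrix.mul_adjugate, hdet]; simp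
        _ = M.adjugate := by rw [← mul_assoc, h1, one_mul]
    rw [Matrix.adjugate_fin_two] at hstar
    have e00 := congr_fun₂ hstar 0 0
    have e01 := congr_fun₂ hstar 0 1
    simp only [Matrix.star_apply, Matrix.of_apply, Matrix.cons_val', Matrix.cons_val_zero,
      Matrix.cons_val_one, Matrix.cons_val_fin_one, RCLike.star_def] at e00 e01
    have e01' : M 0 1 = -(starRingEnd ℂ) (M 1 0) := by rw [e01, neg_neg]
    refine ⟨?_, ?_⟩
    · ext i j
      fin_cases i <;> fin_cases j <;> simp [su2Matrix, e00, e01']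
    · rw [Matrix.det_fin_two, e01', ← e00, Complex.mul_conj'] at hdet
      have := Complex.conj_mul' (M 1 0)
      exact_mod_cast (by linear_combination hdet - this :
        (‖M 0 0‖ : ℂ) ^ 2 + (‖M 1 0‖ : ℂ) ^ 2 = 1)
  · rintro ⟨h, hn⟩
    have hn' : (‖M 0 0‖ : ℂ) ^ 2 + (‖M 1 0‖ : ℂ) ^ 2 = 1 := by exact_mod_cast hn
    rw [← Complex.conj_mul', ← Complex.conj_mul'] at hn'
    rw [h, Matrix.mem_specialUnitaryGroup_iff, Matrix.mem_unitaryGroup_iff']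
    constructor
    · ext i j
      fin_cases i <;> fin_cases j <;>
        simp [su2Matrix, Matrix.mul_apply, Fin.sum_univ_two] <;>
        first | ring1 | linear_combination hn'
    · simp only [su2Matrix, Matrix.det_fin_two_of]
      linear_combination hn'

theorem su2Matrix_mem {a b : ℂ} (h : ‖a‖ ^ 2 + ‖b‖ ^ 2 = 1) :
    su2Matrix a b ∈ Matrix.specialUnitaryGroup (Fin 2) ℂ :=
  (mem_specialUnitaryGroup_fin_two_iff _).2 (by simpa [su2Matrix] using h)

theorem su2Matrix_zero_comm_iff {l a b : ℂ} (hl : (starRingEnd ℂ) l ≠ l) :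
    su2Matrix l 0 * su2Matrix a b = su2Matrix a b * su2Matrix l 0 ↔ b = 0 := by
  constructor
  · intro h
    have h10 := congr_fun₂ h 1 0
    simp only [su2Matrix, Matrix.mul_apply, Fin.sum_univ_two, Matrix.of_apply, Matrix.cons_val',
      Matrix.cons_val_zero, Matrix.cons_val_one, Matrix.cons_val_fin_one] at h10
    have : ((starRingEnd ℂ) l - l) * b = 0 := by linear_combination h10
    exact (mul_eq_zero.1 this).resolve_left (sub_ne_zero.2 hl)
  · rintro rfl
    ext i j
    fin_cases i <;> fin_cases j <;>
      simp [su2Matrix, Matrix.mul_apply, Fin.sum_univ_two, mul_comm]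

/-- Every matrix in `SU(2)` is diagonalised by conjugation within `SU(2)`. -/
theorem exists_diagonalization {A : Matrix (Fin 2) (Fin 2) ℂ}
    (hA : A ∈ Matrix.specialUnitaryGroup (Fin 2) ℂ) :
    ∃ P ∈ Matrix.specialUnitaryGroup (Fin 2) ℂ, ∃ l : ℂ,
      star P * A * P = su2Matrix l 0 ∧ ‖l‖ = 1 := by
  obtain ⟨l, hl⟩ := Module.End.exists_eigenvalue (Matrix.toLin' A)
  obtain ⟨v, hv⟩ := hl.exists_hasEigenvector
  have hAv : A.mulVec v = l • v := by simpa using hv.apply_eq_smul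
  set w : EuclideanSpace ℂ (Fin 2) := WithLp.toLp 2 v with hw
  have hw0 : ‖w‖ ≠ 0 := by
    simpa [hw] using hv.2
  set c : ℂ := (‖w‖ : ℂ)⁻¹
  have hu : ‖c * v 0‖ ^ 2 + ‖c * v 1‖ ^ 2 = 1 := by
    have := EuclideanSpace.norm_sq_eq w
    rw [Fin.sum_univ_two] at this
    simp only [c, norm_mul, norm_inv, Complex.norm_real, norm_norm, mul_pow, ← mul_add]
    rw [show ‖v 0‖ ^ 2 + ‖v 1‖ ^ 2 = ‖w‖ ^ 2 from this.symm]
    field_simp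
  have hP := su2Matrix_mem hu
  refine ⟨_, hP, l, ?_⟩
  set P := su2Matrix (c * v 0) (c * v 1) with hPdef
  have hPP : star P * P = 1 := Matrix.mem_unitaryGroup_iff'.1 hP.1
  have hCmem : star P * A * P ∈ Matrix.specialUnitaryGroup (Fin 2) ℂ :=
    mul_mem (mul_mem (star (⟨P, hP⟩ : Matrix.specialUnitaryGroup (Fin 2) ℂ)).2 hA) hP
  have hcol : ∀ i, (star P * A * P) i 0 = l * (1 : Matrix (Fin 2) (Fin 2) ℂ) i 0 := by
    intro i
    have hAP : ∀ j, (A * P) j 0 = l * P j 0 := by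
      intro j
      have := congr_fun hAv j
      simp only [Matrix.mulVec, dotProduct, Fin.sum_univ_two, Pi.smul_apply, smul_eq_mul] at this
      fin_cases j <;>
        simp [hPdef, su2Matrix, Matrix.mul_apply, Fin.sum_univ_two] at this ⊢ <;>
        linear_combination c * this
    rw [mul_assoc, ← hPP, Matrix.mul_apply, Matrix.mul_apply, Finset.mul_sum]
    exact Finset.sum_congr rfl fun j _ => by rw [hAP]; ring
  obtain ⟨hC, hn⟩ := (mem_specialUnitaryGroup_fin_two_iff _).1 hCmem
  rw [hcol, hcol] at hC hn
  have hn' : ‖l‖ ^ 2 = 1 := by simpa using hn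
  exact ⟨by simpa using hC, (pow_eq_one_iff_of_nonneg (norm_nonneg l) two_ne_zero).1 hn'⟩

/-- Conjugation `B ↦ P⁻¹ B P` by a special unitary matrix `P`. -/
def conjHomeomorph {P : Matrix (Fin 2) (Fin 2) ℂ}
    (hP : P ∈ Matrix.specialUnitaryGroup (Fin 2) ℂ) :
    Matrix (Fin 2) (Fin 2) ℂ ≃ₜ Matrix (Fin 2) (Fin 2) ℂ where
  toFun B := star P * B * P
  invFun B := P * B * star P
  left_inv B := by
    have h := Matrix.mem_unitaryGroup_iff.1 hP.1
    simp [mul_assoc, h, ← mul_assoc P (star P)]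
  right_inv B := by
    have h := Matrix.mem_unitaryGroup_iff'.1 hP.1
    simp [mul_assoc, h, ← mul_assoc (star P) P]
  continuous_toFun := by fun_prop
  continuous_invFun := by fun_prop

/-- The matrices in `SU(2)` with nonzero lower left entry form an open solid torus. -/
noncomputable def offDiagonalHomeomorph :
    {B : Matrix (Fin 2) (Fin 2) ℂ //
      B ∈ Matrix.specialUnitaryGroup (Fin 2) ℂ ∧ B 1 0 ≠ 0} ≃ₜ
    Metric.ball (0 : ℂ) 1 × Metric.sphere (0 : ℂ) 1 where
  toFun B := (⟨B.1 0 0, by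
      have h := ((mem_specialUnitaryGroup_fin_two_iff _).1 B.2.1).2
      have h0 : 0 < ‖B.1 1 0‖ := norm_pos_iff.2 B.2.2
      rw [mem_ball_zero_iff]
      nlinarith [norm_nonneg (B.1 0 0)]⟩,
    ⟨B.1 1 0 / ‖B.1 1 0‖, by
      have h0 : ‖B.1 1 0‖ ≠ 0 := norm_ne_zero_iff.2 B.2.2
      simp [h0]⟩)
  invFun p := ⟨su2Matrix p.1 (p.2 * (√(1 - ‖(p.1 : ℂ)‖ ^ 2) : ℝ)), by
    have hp : ‖(p.1 : ℂ)‖ < 1 := mem_ball_zero_iff.1 p.1.2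
    have hz : ‖(p.2 : ℂ)‖ = 1 := mem_sphere_zero_iff_norm.1 p.2.2
    have hpos : 0 < 1 - ‖(p.1 : ℂ)‖ ^ 2 := by nlinarith [norm_nonneg (p.1 : ℂ)]
    have hz0 : (p.2 : ℂ) ≠ 0 := norm_ne_zero_iff.1 (by simp [hz])
    refine ⟨su2Matrix_mem ?_, ?_⟩
    · rw [norm_mul, hz, one_mul, Complex.norm_real, Real.norm_eq_abs, sq_abs,
        Real.sq_sqrt hpos.le]
      ring
    · have := (Real.sqrt_pos.2 hpos).ne'
      simpa [su2Matrix, hz0] using this⟩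
  left_inv B := by
    obtain ⟨hB, hn⟩ := (mem_specialUnitaryGroup_fin_two_iff _).1 B.2.1
    have h0 : ‖B.1 1 0‖ ≠ 0 := norm_ne_zero_iff.2 B.2.2
    have hs : √(1 - ‖B.1 0 0‖ ^ 2) = ‖B.1 1 0‖ := by
      rw [show 1 - ‖B.1 0 0‖ ^ 2 = ‖B.1 1 0‖ ^ 2 by linarith, Real.sqrt_sq (norm_nonneg _)]
    apply Subtype.ext
    simp only [hs]
    rw [div_mul_cancel₀ _ (by exact_mod_cast h0)]
    exact hB.symm
  right_inv p := by
    have hp : ‖(p.1 : ℂ)‖ < 1 := mem_ball_zero_iff.1 p.1.2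
    have hz : ‖(p.2 : ℂ)‖ = 1 := mem_sphere_zero_iff_norm.1 p.2.2
    have hs := Real.sqrt_pos.2
      (show 0 < 1 - ‖(p.1 : ℂ)‖ ^ 2 by nlinarith [norm_nonneg (p.1 : ℂ)])
    have hs' : ((√(1 - ‖(p.1 : ℂ)‖ ^ 2) : ℝ) : ℂ) ≠ 0 := by exact_mod_cast hs.ne'
    refine Prod.ext (Subtype.ext ?_) (Subtype.ext ?_)
    · simp [su2Matrix]
    · simp only [su2Matrix, Matrix.of_apply, Matrix.cons_val', Matrix.cons_val_zero,
        Matrix.cons_val_one, Matrix.cons_val_fin_one, norm_mul, hz, one_mul, Complex.norm_real,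
        Real.norm_eq_abs, abs_of_pos hs]
      exact mul_div_cancel_right₀ _ hs'
  continuous_toFun := by
    have h10 : Continuous fun B : {B : Matrix (Fin 2) (Fin 2) ℂ //
        B ∈ Matrix.specialUnitaryGroup (Fin 2) ℂ ∧ B 1 0 ≠ 0} => B.1 1 0 :=
      continuous_subtype_val.matrix_elem 1 0
    refine .prodMk (.subtype_mk (continuous_subtype_val.matrix_elem 0 0) _) (.subtype_mk ?_ _)
    exact h10.div (Complex.continuous_ofReal.comp h10.norm) fun B => by
      simpa using B.2.2
  continuous_invFun := by
    refine .subtype_mk (continuous_matrix fun i j => ?_) _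
    fin_cases i <;> fin_cases j <;> simp [su2Matrix] <;> fun_prop

/-- Let `A ∈ SU(2)` with `A ≠ I` and `A ≠ −I`.  Then the complement in `SU(2)` of the
centralizer of `A`, i.e. the subspace `{B ∈ SU(2) | AB ≠ BA}`, is homotopy equivalent to
the circle `S¹` (the unit circle in `ℂ`). -/
theorem complement_of_centralizer_in_SU2_homotopyEquiv_circle
    (A : Matrix (Fin 2) (Fin 2) ℂ)
    (hA : A ∈ Matrix.specialUnitaryGroup (Fin 2) ℂ)
    (h1 : A ≠ 1) (h2 : A ≠ -1) :
    Nonempty (ContinuousMap.HomotopyEquiv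
      {B : Matrix (Fin 2) (Fin 2) ℂ //
        B ∈ Matrix.specialUnitaryGroup (Fin 2) ℂ ∧ A * B ≠ B * A}
      (Metric.sphere (0 : ℂ) 1)) := by
  obtain ⟨P, hP, l, hPA, hl⟩ := exists_diagonalization hA
  have hPP : P * star P = 1 := Matrix.mem_unitaryGroup_iff.1 hP.1
  have hPs : star P ∈ Matrix.specialUnitaryGroup (Fin 2) ℂ :=
    (star (⟨P, hP⟩ : Matrix.specialUnitaryGroup (Fin 2) ℂ)).2
  have hAP : A = P * su2Matrix l 0 * star P := by
    rw [← hPA]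
    exact ((conjHomeomorph hP).left_inv A).symm
  have hconj : (starRingEnd ℂ) l ≠ l := by
    intro h
    obtain ⟨r, rfl⟩ := Complex.conj_eq_iff_real.1 h
    rw [Complex.norm_real, Real.norm_eq_abs] at hl
    rcases eq_or_eq_neg_of_abs_eq hl with rfl | rfl
    · refine h1 ?_
      have : su2Matrix ((1 : ℝ) : ℂ) 0 = 1 := by
        ext i j; fin_cases i <;> fin_cases j <;> simp [su2Matrix]
      rw [hAP, this, mul_one, hPP]
    · refine h2 ?_
      have : su2Matrix ((-1 : ℝ) : ℂ) 0 = -1 := by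
        ext i j; fin_cases i <;> fin_cases j <;> simp [su2Matrix]
      rw [hAP, this, mul_neg, mul_one, neg_mul, hPP]
  have hiff : ∀ B, (B ∈ Matrix.specialUnitaryGroup (Fin 2) ℂ ∧ A * B ≠ B * A) ↔
      (conjHomeomorph hP B ∈ Matrix.specialUnitaryGroup (Fin 2) ℂ ∧
        conjHomeomorph hP B 1 0 ≠ 0) := by
    intro B
    have hB : B = P * conjHomeomorph hP B * star P := ((conjHomeomorph hP).left_inv B).symm
    have hmem : B ∈ Matrix.specialUnitaryGroup (Fin 2) ℂ ↔
        conjHomeomorph hP B ∈ Matrix.specialUnitaryGroup (Fin 2) ℂ :=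
      ⟨fun h => mul_mem (mul_mem hPs h) hP, fun h => hB ▸ mul_mem (mul_mem hP h) hPs⟩
    rw [hmem]
    refine and_congr_right fun hC => not_congr ?_
    have hmul (X Y : Matrix (Fin 2) (Fin 2) ℂ) :
        conjHomeomorph hP (X * Y) = conjHomeomorph hP X * conjHomeomorph hP Y := by
      simp [conjHomeomorph, mul_assoc, ← mul_assoc P (star P), hPP]
    rw [← (conjHomeomorph hP).injective.eq_iff, hmul, hmul,
      show conjHomeomorph hP A = su2Matrix l 0 from hPA]
    have hCeq := ((mem_specialUnitaryGroup_fin_two_iff _).1 hC).1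
    generalize conjHomeomorph hP B = C at hCeq
    conv_lhs => rw [hCeq]
    exact su2Matrix_zero_comm_iff hconj
  have : ContractibleSpace (Metric.ball (0 : ℂ) 1) :=
    (convex_ball 0 1).contractibleSpace ⟨0, by simp⟩
  obtain ⟨e⟩ := ContractibleSpace.hequiv_unit (Metric.ball (0 : ℂ) 1)
  exact ⟨(((conjHomeomorph hP).subtype hiff).trans offDiagonalHomeomorph).toHomotopyEquiv.trans
    ((e.prodCongr (.refl _)).trans (Homeomorph.punitProd _).toHomotopyEquiv)⟩
end

section
/- Fix r ≥ 1. Let E = {(x, y₁, …, y_r) ∈ SU(2)^{r+1} | x yᵢ ≠ yᵢ x for some i} be the complement of Hom(ℤ × F_r, SU(2)) in SU(2)^{r+1}, and let p : E → SU(2) ∖ {±I} be the map (x, y₁, …, y_r) ↦ x (whose image indeed lies in SU(2) ∖ {±I}). Then p is a locally trivial fiber bundle with fiber F = SU(2)^r ∖ 𝕋^r: for every x₀ ∈ SU(2) ∖ {±I} there exist an open neighborhood U of x₀ in SU(2) ∖ {±I} and a homeomorphism p⁻¹(U) ≅ U × F commuting with the projections to U, where 𝕋 ⊆ SU(2) is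 the subgroup of diagonal matrices and 𝕋^r ⊆ SU(2)^r the corresponding r-torus. -/
/-- `SU(2)` as a topological space: the subspace of `2 × 2` complex matrices lying in the
special unitary group. -/
def SU2 : Type :=
  {x : Matrix (Fin 2) (Fin 2) ℂ // x ∈ Matrix.specialUnitaryGroup (Fin 2) ℂ}

instance : TopologicalSpace SU2 :=
  inferInstanceAs (TopologicalSpace
    {x : Matrix (Fin 2) (Fin 2) ℂ // x ∈ Matrix.specialUnitaryGroup (Fin 2) ℂ})

/-- The complement `E` of `Hom(ℤ × F_r, SU(2))` in `SU(2)^{r+1}`: tuples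
`(x, y₁, …, y_r)` such that `x` fails to commute with some `yᵢ`. -/
def NonCommE (r : ℕ) : Type :=
  {v : SU2 × (Fin r → SU2) // ∃ i, v.1.1 * (v.2 i).1 ≠ (v.2 i).1 * v.1.1}

instance (r : ℕ) : TopologicalSpace (NonCommE r) :=
  inferInstanceAs (TopologicalSpace
    {v : SU2 × (Fin r → SU2) // ∃ i, v.1.1 * (v.2 i).1 ≠ (v.2 i).1 * v.1.1})

/-- The fiber `F = SU(2)^r ∖ 𝕋^r`, where `𝕋 ⊆ SU(2)` is the subgroup of diagonal
matrices. -/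
def NonCommFiber (r : ℕ) : Type :=
  {y : Fin r → SU2 // ¬ ∀ i, ((y i).1).IsDiag}

instance (r : ℕ) : TopologicalSpace (NonCommFiber r) :=
  inferInstanceAs (TopologicalSpace {y : Fin r → SU2 // ¬ ∀ i, ((y i).1).IsDiag})

open Matrix

namespace SU2

theorem star_mul_self (g : SU2) : star g.1 * g.1 = 1 :=
  mem_unitaryGroup_iff'.mp (mem_specialUnitaryGroup_iff.mp g.2).1

theorem mul_star_self (g : SU2) : g.1 * star g.1 = 1 :=
  mem_unitaryGroup_iff.mp (mem_specialUnitaryGroup_iff.mp g.2).1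

theorem det_eq_one (g : SU2) : g.1.det = 1 :=
  (mem_specialUnitaryGroup_iff.mp g.2).2

theorem star_eq_adjugate (g : SU2) : star g.1 = g.1.adjugate := by
  calc star g.1 = star g.1 * (g.1 * g.1.adjugate) := by
        rw [mul_adjugate, g.det_eq_one, one_smul, mul_one]
    _ = g.1.adjugate := by rw [← mul_assoc, g.star_mul_self, one_mul]

theorem apply_one_one (g : SU2) : g.1 1 1 = star (g.1 0 0) := by
  have h := congrFun (congrFun g.star_eq_adjugate 0) 0
  simpa [adjugate_fin_two, star_apply] using h.symm

theorem apply_one_zero (g : SU2) : g.1 1 0 = -star (g.1 0 1) := by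
  have h := congrFun (congrFun g.star_eq_adjugate 1) 0
  simp only [adjugate_fin_two, star_apply] at h
  simp [h]

theorem normSq_add_normSq (g : SU2) :
    Complex.normSq (g.1 0 0) + Complex.normSq (g.1 0 1) = 1 := by
  have h := g.det_eq_one
  rw [det_fin_two, g.apply_one_one, g.apply_one_zero] at h
  apply Complex.ofReal_injective
  push_cast
  rw [← Complex.mul_conj, ← Complex.mul_conj, ← h]
  simp

/-- The element of `SU(2)` whose first row is `(p, q)`. -/
def ofRow (p q : ℂ) (h : Complex.normSq p + Complex.normSq q = 1) : SU2 :=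
  ⟨!![p, q; -star q, star p], by
    have h' : p * star p + q * star q = 1 := by
      have := congrArg Complex.ofReal h
      push_cast at this
      rwa [← Complex.mul_conj, ← Complex.mul_conj] at this
    rw [mem_specialUnitaryGroup_iff, mem_unitaryGroup_iff]
    refine ⟨?_, by rw [det_fin_two_of, ← h']; ring⟩
    ext i j
    fin_cases i <;> fin_cases j <;>
      simp [Matrix.mul_apply, star_apply, Fin.sum_univ_two] <;>
      simp only [Complex.star_def] at h' <;> first | linear_combination h' | ring⟩

theorem continuous_val : Continuous (fun x : SU2 => x.1) := continuous_subtype_val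

theorem continuous_apply (i j : Fin 2) : Continuous (fun x : SU2 => x.1 i j) :=
  continuous_val.matrix_elem i j

/-- The norm of the imaginary part of `x`, seen as a unit quaternion. -/
noncomputable def imNorm (x : SU2) : ℝ := √((x.1 0 0).im ^ 2 + Complex.normSq (x.1 0 1))

theorem imNorm_sq (x : SU2) :
    x.imNorm ^ 2 = (x.1 0 0).im ^ 2 + Complex.normSq (x.1 0 1) :=
  Real.sq_sqrt (add_nonneg (sq_nonneg _) (Complex.normSq_nonneg _))

theorem continuous_imNorm : Continuous imNorm := by
  have h0 := continuous_apply 0 0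
  have h1 := continuous_apply 0 1
  have := Complex.continuous_normSq.comp h1
  unfold imNorm
  exact Real.continuous_sqrt.comp (((Complex.continuous_im.comp h0).pow 2).add this)

/-- The squared norm of the unnormalized frame `(i (im x₀₀ + ε |im x|), x₀₁)` diagonalizing `x`. -/
noncomputable def frameNormSq (ε : ℝ) (x : SU2) : ℝ :=
  ((x.1 0 0).im + ε * x.imNorm) ^ 2 + Complex.normSq (x.1 0 1)

theorem frameNormSq_nonneg (ε : ℝ) (x : SU2) : 0 ≤ x.frameNormSq ε :=
  add_nonneg (sq_nonneg _) (Complex.normSq_nonneg _)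

theorem continuous_frameNormSq (ε : ℝ) : Continuous (frameNormSq ε) := by
  have h0 := continuous_apply 0 0
  have h1 := Complex.continuous_normSq.comp (continuous_apply 0 1)
  have hs := continuous_imNorm
  unfold frameNormSq
  exact ((((Complex.continuous_im.comp h0).add (continuous_const.mul hs))).pow 2).add h1

theorem imNorm_ne_zero {ε : ℝ} {x : SU2} (h : x.frameNormSq ε ≠ 0) : x.imNorm ≠ 0 := by
  intro hs
  have h2 := x.imNorm_sq
  apply h
  rw [frameNormSq, hs]
  rw [hs] at h2
  linarith

theorem ne_one_of_imNorm_ne_zero {x : SU2} (h : x.imNorm ≠ 0) : x.1 ≠ 1 ∧ x.1 ≠ -1 := by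
  constructor <;> intro hx <;> apply h <;> simp [imNorm, hx]

theorem exists_frameNormSq_ne_zero {x : SU2} (h1 : x.1 ≠ 1) (h2 : x.1 ≠ -1) :
    ∃ ε : ℝ, ε ^ 2 = 1 ∧ x.frameNormSq ε ≠ 0 := by
  by_contra! H
  have e1 := H 1 (by norm_num)
  have e2 := H (-1) (by norm_num)
  simp only [frameNormSq] at e1 e2
  have hq := Complex.normSq_nonneg (x.1 0 1)
  have hb : Complex.normSq (x.1 0 1) = 0 := by
    nlinarith [sq_nonneg ((x.1 0 0).im + 1 * x.imNorm)]
  have hi : (x.1 0 0).im = 0 := by nlinarith [x.imNorm_sq]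
  have hr := x.normSq_add_normSq
  rw [hb, Complex.normSq_apply, hi] at hr
  have h01 := Complex.normSq_eq_zero.mp hb
  have h10 := x.apply_one_zero
  have h11 := x.apply_one_one
  have hr' : ((x.1 0 0).re - 1) * ((x.1 0 0).re + 1) = 0 := by linarith
  rcases mul_eq_zero.mp hr' with hr' | hr'
  · have h00 : x.1 0 0 = 1 := Complex.ext (by simp; linarith) (by simpa using hi)
    apply h1
    ext i j
    fin_cases i <;> fin_cases j <;> simp [h00, h01, h10, h11]
  · have h00 : x.1 0 0 = -1 := Complex.ext (by simp; linarith) (by simpa using hi)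
    apply h2
    ext i j
    fin_cases i <;> fin_cases j <;> simp [h00, h01, h10, h11]

/-- The normalized frame diagonalizing `x`. -/
noncomputable def frame (ε : ℝ) (x : {x : SU2 // x.frameNormSq ε ≠ 0}) : SU2 :=
  ofRow (((√(x.1.frameNormSq ε))⁻¹ : ℝ) *
      (Complex.I * (((x.1.1 0 0).im + ε * x.1.imNorm : ℝ) : ℂ)))
    (((√(x.1.frameNormSq ε))⁻¹ : ℝ) * x.1.1 0 1) (by
      simp only [Complex.normSq_mul, Complex.normSq_ofReal, Complex.normSq_I]
      have h := Real.mul_self_sqrt (x.1.frameNormSq_nonneg ε)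
      have h0 : √(x.1.frameNormSq ε) ≠ 0 :=
        (Real.sqrt_ne_zero (x.1.frameNormSq_nonneg ε)).mpr x.2
      field_simp
      rw [pow_two (√_), h, frameNormSq])

theorem continuous_frame (ε : ℝ) : Continuous (frame ε) := by
  have hN : Continuous (fun x : {x : SU2 // x.frameNormSq ε ≠ 0} => √(x.1.frameNormSq ε)) :=
    Real.continuous_sqrt.comp ((continuous_frameNormSq ε).comp continuous_subtype_val)
  have hi := Complex.continuous_ofReal.comp (hN.inv₀ fun x =>
    (Real.sqrt_ne_zero (x.1.frameNormSq_nonneg ε)).mpr x.2)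
  have h0 := Complex.continuous_im.comp ((continuous_apply 0 0).comp
    (continuous_subtype_val (p := fun x : SU2 => x.frameNormSq ε ≠ 0)))
  have h1 := (continuous_apply 0 1).comp
    (continuous_subtype_val (p := fun x : SU2 => x.frameNormSq ε ≠ 0))
  have hs := continuous_imNorm.comp
    (continuous_subtype_val (p := fun x : SU2 => x.frameNormSq ε ≠ 0))
  have hp := hi.mul (continuous_const (y := Complex.I) |>.mul
    (Complex.continuous_ofReal.comp (h0.add (continuous_const (y := ε) |>.mul hs))))
  have hq := hi.mul h1
  refine Continuous.subtype_mk (continuous_matrix fun i j => ?_) _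
  fin_cases i <;> fin_cases j
  · exact hp
  · exact hq
  · exact hq.star.neg
  · exact hp.star

theorem mul_frame {ε : ℝ} (hε : ε ^ 2 = 1) (x : {x : SU2 // x.frameNormSq ε ≠ 0}) :
    x.1.1 * (frame ε x).1 = (frame ε x).1 *
      diagonal ![((x.1.1 0 0).re : ℂ) + Complex.I * (ε * x.1.imNorm : ℝ),
        ((x.1.1 0 0).re : ℂ) - Complex.I * (ε * x.1.imNorm : ℝ)] := by
  have hs := congrArg Complex.ofReal x.1.imNorm_sq
  push_cast at hs
  rw [← Complex.mul_conj] at hs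
  have hε' := congrArg Complex.ofReal hε
  push_cast at hε'
  have h00 := Complex.re_add_im (x.1.1 0 0)
  have h10 := x.1.apply_one_zero
  have h11 := x.1.apply_one_one
  have hc : star (x.1.1 0 0) = ((x.1.1 0 0).re : ℂ) - (x.1.1 0 0).im * Complex.I := by
    apply Complex.ext <;> simp
  rw [hc] at h11
  set n : ℂ := ((√(x.1.frameNormSq ε) : ℝ) : ℂ)⁻¹ with hn
  have hnc : starRingEnd ℂ n = n := by simp [hn]
  set s : ℂ := (x.1.imNorm : ℂ)
  set β : ℂ := ((x.1.1 0 0).im : ℂ)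
  ext i j
  fin_cases i <;> fin_cases j <;>
    simp [frame, ofRow, Matrix.mul_apply, Fin.sum_univ_two, diagonal, h10, h11, ← hn, hnc]
  · linear_combination (-n * Complex.I * (β + ε * s)) * h00 + n * s ^ 2 * hε' + n * hs +
      n * (β + ε * s) * (β - ε * s) * Complex.I_sq
  · linear_combination (-n * x.1.1 0 1) * h00
  · ring
  · linear_combination n * s ^ 2 * hε' + n * hs +
      n * (β + ε * s) * (β - ε * s) * Complex.I_sq

theorem star_mem (g : SU2) : star g.1 ∈ specialUnitaryGroup (Fin 2) ℂ := by
  refine mem_specialUnitaryGroup_iff.mpr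
    ⟨Unitary.star_mem (mem_specialUnitaryGroup_iff.mp g.2).1, ?_⟩
  rw [star_eq_conjTranspose, det_conjTranspose, g.det_eq_one, star_one]

/-- Conjugation `y ↦ g y g⁻¹` on `SU(2)`. -/
def conj (g y : SU2) : SU2 :=
  ⟨g.1 * y.1 * star g.1, mul_mem (mul_mem g.2 y.2) g.star_mem⟩

/-- The inverse conjugation `y ↦ g⁻¹ y g` on `SU(2)`. -/
def conjInv (g y : SU2) : SU2 :=
  ⟨star g.1 * y.1 * g.1, mul_mem (mul_mem g.star_mem y.2) g.2⟩

theorem conj_conjInv (g y : SU2) : conj g (conjInv g y) = y := by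
  apply Subtype.ext
  calc g.1 * (star g.1 * y.1 * g.1) * star g.1
      = (g.1 * star g.1) * y.1 * (g.1 * star g.1) := by noncomm_ring
    _ = y.1 := by rw [g.mul_star_self, one_mul, mul_one]

theorem conjInv_conj (g y : SU2) : conjInv g (conj g y) = y := by
  apply Subtype.ext
  calc star g.1 * (g.1 * y.1 * star g.1) * g.1
      = (star g.1 * g.1) * y.1 * (star g.1 * g.1) := by noncomm_ring
    _ = y.1 := by rw [g.star_mul_self, one_mul, mul_one]

theorem _root_.Continuous.su2_conj {X : Type*} [TopologicalSpace X] {g y : X → SU2}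
    (hg : Continuous g) (hy : Continuous y) : Continuous fun a => conj (g a) (y a) := by
  have h1 := continuous_val.comp hg
  have h2 := continuous_val.comp hy
  exact Continuous.subtype_mk ((h1.mul h2).mul h1.star) _

theorem _root_.Continuous.su2_conjInv {X : Type*} [TopologicalSpace X] {g y : X → SU2}
    (hg : Continuous g) (hy : Continuous y) : Continuous fun a => conjInv (g a) (y a) := by
  have h1 := continuous_val.comp hg
  have h2 := continuous_val.comp hy
  exact Continuous.subtype_mk ((h1.star.mul h2).mul h1) _

/-- A matrix commutes with a diagonal matrix with distinct entries iff it is diagonal. -/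
theorem _root_.Matrix.diagonal_commute_iff_isDiag {n R : Type*} [Fintype n] [DecidableEq n]
    [CommRing R] [IsDomain R] {d : n → R} (hd : Function.Injective d) (A : Matrix n n R) :
    diagonal d * A = A * diagonal d ↔ A.IsDiag := by
  constructor
  · intro h i j hij
    have hh := congrFun (congrFun h i) j
    rw [diagonal_mul, mul_diagonal] at hh
    have : (d i - d j) * A i j = 0 := by linear_combination hh
    exact (mul_eq_zero.mp this).resolve_left (sub_ne_zero.mpr (hd.ne hij))
  · intro h
    rw [← h.diagonal_diag, diagonal_mul_diagonal, diagonal_mul_diagonal]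
    simp only [mul_comm]

theorem commute_iff_isDiag {x g : SU2} {d : Fin 2 → ℂ} (hd : Function.Injective d)
    (hx : x.1 * g.1 = g.1 * diagonal d) (y : SU2) :
    x.1 * y.1 = y.1 * x.1 ↔ (conjInv g y).1.IsDiag := by
  have hD : diagonal d = star g.1 * x.1 * g.1 := by
    rw [mul_assoc, hx, ← mul_assoc, g.star_mul_self, one_mul]
  have hxD : x.1 = g.1 * diagonal d * star g.1 := by
    rw [← hx, mul_assoc, g.mul_star_self, mul_one]
  rw [← diagonal_commute_iff_isDiag hd]
  have e1 : diagonal d * (conjInv g y).1 = star g.1 * (x.1 * y.1) * g.1 := by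
    calc diagonal d * (star g.1 * y.1 * g.1)
        = star g.1 * x.1 * (g.1 * star g.1) * y.1 * g.1 := by rw [hD]; noncomm_ring
      _ = _ := by rw [g.mul_star_self, mul_one]; noncomm_ring
  have e2 : (conjInv g y).1 * diagonal d = star g.1 * (y.1 * x.1) * g.1 := by
    calc (star g.1 * y.1 * g.1) * diagonal d
        = star g.1 * y.1 * (g.1 * star g.1) * x.1 * g.1 := by rw [hD]; noncomm_ring
      _ = _ := by rw [g.mul_star_self, mul_one]; noncomm_ring
  rw [e1, e2]
  refine ⟨fun h => by rw [h], fun h => ?_⟩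
  have h' := congrArg (fun A => g.1 * A * star g.1) h
  have key : ∀ A : Matrix (Fin 2) (Fin 2) ℂ, g.1 * (star g.1 * A * g.1) * star g.1 = A := by
    intro A
    calc g.1 * (star g.1 * A * g.1) * star g.1
        = (g.1 * star g.1) * A * (g.1 * star g.1) := by noncomm_ring
      _ = A := by rw [g.mul_star_self, one_mul, mul_one]
  simpa only [key] using h'

theorem frame_commute_iff {ε : ℝ} (hε : ε ^ 2 = 1) (x : {x : SU2 // x.frameNormSq ε ≠ 0})
    (y : SU2) : x.1.1 * y.1 = y.1 * x.1.1 ↔ (conjInv (frame ε x) y).1.IsDiag := by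
  refine commute_iff_isDiag ?_ (mul_frame hε x) y
  have hs : ((ε * x.1.imNorm : ℝ) : ℂ) ≠ 0 :=
    Complex.ofReal_ne_zero.mpr (mul_ne_zero (by rintro rfl; norm_num at hε) (imNorm_ne_zero x.2))
  have hne : ((x.1.1 0 0).re : ℂ) + Complex.I * (ε * x.1.imNorm : ℝ) ≠
      ((x.1.1 0 0).re : ℂ) - Complex.I * (ε * x.1.imNorm : ℝ) := by
    intro h
    have : 2 * Complex.I * ((ε * x.1.imNorm : ℝ) : ℂ) = 0 := by linear_combination h
    simp only [mul_eq_zero, hs, Complex.I_ne_zero, OfNat.ofNat_ne_zero, or_self] at this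
  intro i j hij
  fin_cases i <;> fin_cases j
  · rfl
  · exact absurd hij hne
  · exact absurd hij.symm hne
  · rfl

theorem continuous_noncommE_fst {r : ℕ} : Continuous (fun e : NonCommE r => e.1.1) :=
  continuous_fst.comp continuous_subtype_val

theorem continuous_noncommE_snd {r : ℕ} (i : Fin r) :
    Continuous (fun e : NonCommE r => e.1.2 i) :=
  (_root_.continuous_apply i).comp (continuous_snd.comp continuous_subtype_val)

theorem continuous_noncommFiber_apply {r : ℕ} (i : Fin r) :
    Continuous (fun y : NonCommFiber r => y.1 i) :=
  (_root_.continuous_apply i).comp continuous_subtype_val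

/-- The local trivialization `(x, y) ↦ (x, g(x)⁻¹ y g(x))` of the noncommuting complement, where
`g` is the diagonalizing frame. -/
noncomputable def trivialization {ε : ℝ} (hε : ε ^ 2 = 1) (r : ℕ) :
    ((fun e : NonCommE r => e.1.1) ⁻¹' {x | x.frameNormSq ε ≠ 0}) ≃ₜ
      {x : SU2 | x.frameNormSq ε ≠ 0} × NonCommFiber r where
  toFun e := (⟨e.1.1.1, e.2⟩, ⟨fun i => conjInv (frame ε ⟨e.1.1.1, e.2⟩) (e.1.1.2 i), fun h =>
    e.1.2.elim fun i hi => hi ((frame_commute_iff hε ⟨e.1.1.1, e.2⟩ _).mpr (h i))⟩)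
  invFun v := ⟨⟨(v.1.1, fun i => conj (frame ε v.1) (v.2.1 i)), by
    by_contra! H
    refine v.2.2 fun i => ?_
    have := (frame_commute_iff hε v.1 _).mp (H i)
    rwa [conjInv_conj] at this⟩, v.1.2⟩
  left_inv e := Subtype.ext (Subtype.ext (Prod.ext rfl (funext fun i => conj_conjInv _ _)))
  right_inv v := Prod.ext rfl (Subtype.ext (funext fun i => conjInv_conj _ _))
  continuous_toFun := by
    have hx : Continuous fun e : (fun e : NonCommE r => e.1.1) ⁻¹' {x | x.frameNormSq ε ≠ 0} =>
        (⟨e.1.1.1, e.2⟩ : {x : SU2 // x.frameNormSq ε ≠ 0}) :=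
      Continuous.subtype_mk (continuous_noncommE_fst.comp continuous_subtype_val) _
    have hy (i : Fin r) :
        Continuous fun e : (fun e : NonCommE r => e.1.1) ⁻¹' {x | x.frameNormSq ε ≠ 0} =>
          e.1.1.2 i :=
      (continuous_noncommE_snd i).comp continuous_subtype_val
    exact Continuous.prodMk hx (Continuous.subtype_mk (continuous_pi fun i =>
      ((continuous_frame ε).comp hx).su2_conjInv (hy i)) _)
  continuous_invFun := by
    have hg : Continuous fun v : {x : SU2 | x.frameNormSq ε ≠ 0} × NonCommFiber r =>
        frame ε v.1 := (continuous_frame ε).comp continuous_fst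
    have hy (i : Fin r) : Continuous fun v : {x : SU2 | x.frameNormSq ε ≠ 0} × NonCommFiber r =>
        v.2.1 i := (continuous_noncommFiber_apply i).comp continuous_snd
    exact Continuous.subtype_mk (Continuous.subtype_mk (Continuous.prodMk
      (continuous_subtype_val.comp continuous_fst)
      (continuous_pi fun i => hg.su2_conj (hy i))) _) _

end SU2

/-- For `r ≥ 1`, the first-coordinate projection `p : E → SU(2) ∖ {±I}` on the complement
`E` of `Hom(ℤ × F_r, SU(2))` in `SU(2)^{r+1}` is well defined (its image avoids `±I`) and
is a locally trivial fiber bundle with fiber `F = SU(2)^r ∖ 𝕋^r`: every point of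
`SU(2) ∖ {±I}` has an open neighborhood `U` over which there is a homeomorphism
`p⁻¹(U) ≅ U × F` commuting with the projections to `U`. -/
theorem noncommuting_complement_is_fiber_bundle (r : ℕ) (hr : 1 ≤ r) :
    (∀ e : NonCommE r, (e.1.1).1 ≠ 1 ∧ (e.1.1).1 ≠ -1) ∧
    ∀ x₀ : SU2, x₀.1 ≠ 1 → x₀.1 ≠ -1 →
      ∃ U : Set SU2, IsOpen U ∧ x₀ ∈ U ∧ (∀ x ∈ U, x.1 ≠ 1 ∧ x.1 ≠ -1) ∧
        ∃ φ : ((fun e : NonCommE r => e.1.1) ⁻¹' U) ≃ₜ U × NonCommFiber r,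
          ∀ e : ((fun e : NonCommE r => e.1.1) ⁻¹' U),
            ((φ e).1 : SU2) = (e : NonCommE r).1.1 := by
  refine ⟨fun e => ?_, fun x₀ h1 h2 => ?_⟩
  · obtain ⟨i, hi⟩ := e.2
    constructor <;> intro h <;> apply hi <;> simp [h]
  · obtain ⟨ε, hε, hx₀⟩ := SU2.exists_frameNormSq_ne_zero h1 h2
    exact ⟨{x | x.frameNormSq ε ≠ 0}, isOpen_ne_fun (SU2.continuous_frameNormSq ε) continuous_const,
      hx₀, fun x hx => SU2.ne_one_of_imNorm_ne_zero (SU2.imNorm_ne_zero hx),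
      SU2.trivialization hε r, fun _ => rfl⟩
end

section
/- Let (X, A) be an NDR-pair, represented by (h, u), and fix integers 1 ≤ r ≤ n. Let F_rX^n ⊆ X^n denote the subspace of n-tuples (x₁,…,xₙ) for which at least r of the coordinates xⱼ lie in A. Then (X^n, F_rX^n) is an NDR-pair; moreover a representation (h_n, u_{r,n}) can be chosen Σ_n-equivariantly, i.e., with u_{r,n} : X^n → [0,1] invariant under permutations of the coordinates and h_n : [0,1] × X^n → X^n equivariant for the coordinate-permutation action of the symmetric group Σ_n. -/
/-- `(h, u)` represents `(X, A)` as an NDR-pair (Steenrod): `u : X → [0,1]` and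
`h : [0,1] × X → X` are continuous, `A = u⁻¹(0)`, `h(0, x) = x`, `h(t, a) = a` for
`a ∈ A`, and `h(1, x) ∈ A` whenever `u(x) < 1`. -/
def RepresentsNDR {X : Type*} [TopologicalSpace X] (A : Set X)
    (h : unitInterval × X → X) (u : X → ℝ) : Prop :=
  Continuous u ∧ Continuous h ∧ (∀ x, u x ∈ unitInterval) ∧
    A = u ⁻¹' {0} ∧
    (∀ x, h (0, x) = x) ∧
    (∀ t : unitInterval, ∀ a ∈ A, h (t, a) = a) ∧
    (∀ x, u x < 1 → h (1, x) ∈ A)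

/-- `F_r X^n ⊆ X^n`: the subspace of `n`-tuples having at least `r` coordinates in `A`. -/
def FatWedge {X : Type*} (A : Set X) (n r : ℕ) : Set (Fin n → X) :=
  {x | ∃ s : Finset (Fin n), r ≤ s.card ∧ ∀ j ∈ s, x j ∈ A}

open Topology in
/-- Along a homotopy that is stationary on `A`, the time parameter may be discontinuous at
points lying over `A`. -/
lemma continuous_homotopy_reparam {X Y : Type*} [TopologicalSpace X] [TopologicalSpace Y]
    {A : Set X} {h : unitInterval × X → X} (hh : Continuous h)
    (hA : ∀ t : unitInterval, ∀ a ∈ A, h (t, a) = a)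
    {g : Y → unitInterval} {f : Y → X} (hf : Continuous f)
    (hg : ∀ y, f y ∉ A → ContinuousAt g y) :
    Continuous fun y => h (g y, f y) := by
  refine continuous_iff_continuousAt.2 fun y => ?_
  by_cases hy : f y ∈ A
  · intro W hW
    simp only [hA _ _ hy] at hW
    have key : ∀ᶠ x in 𝓝 (f y), ∀ t ∈ (Set.univ : Set unitInterval), h (t, x) ∈ W := by
      refine isCompact_univ.eventually_forall_of_forall_eventually fun t _ => ?_
      have : Filter.Tendsto (fun z : X × unitInterval => h (z.2, z.1)) (𝓝 (f y, t))
          (𝓝 (h (t, f y))) :=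
        (hh.comp (continuous_snd.prodMk continuous_fst)).continuousAt
      rw [hA t _ hy] at this
      exact this hW
    exact (hf.continuousAt.eventually key).mono fun z hz => hz _ (Set.mem_univ _)
  · exact hh.continuousAt.comp ((hg y hy).prodMk hf.continuousAt)

/-- The `r`-th smallest entry of a finite family in the unit interval. -/
noncomputable def rthSmallest {n : ℕ} (r : ℕ) (a : Fin n → unitInterval) : unitInterval :=
  {s : Finset (Fin n) | r ≤ s.card}.toFinset.inf fun s => s.sup a

lemma rthSmallest_le {n r : ℕ} (a : Fin n → unitInterval) {c : unitInterval}
    {s : Finset (Fin n)} (hs : r ≤ s.card) (hc : ∀ j ∈ s, a j ≤ c) :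
    rthSmallest r a ≤ c :=
  (Finset.inf_le (f := fun s : Finset (Fin n) => s.sup a) (by simpa using hs)).trans
    (Finset.sup_le hc)

lemma exists_le_rthSmallest {n r : ℕ} (hrn : r ≤ n) (a : Fin n → unitInterval) :
    ∃ s : Finset (Fin n), r ≤ s.card ∧ ∀ j ∈ s, a j ≤ rthSmallest r a := by
  obtain ⟨s, hs, h⟩ := Finset.exists_mem_eq_inf
    {s : Finset (Fin n) | r ≤ s.card}.toFinset ⟨Finset.univ, by simpa using hrn⟩
    fun s => s.sup a
  refine ⟨s, by simpa using hs, fun j hj => ?_⟩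
  rw [rthSmallest, h]
  exact Finset.le_sup hj

lemma continuous_rthSmallest {n : ℕ} (r : ℕ) :
    Continuous (rthSmallest r : (Fin n → unitInterval) → unitInterval) :=
  Continuous.finset_inf_apply fun _ _ =>
    Continuous.finset_sup_apply fun j _ => continuous_apply j

lemma rthSmallest_comp_perm_le {n r : ℕ} (hrn : r ≤ n) (a : Fin n → unitInterval)
    (σ : Equiv.Perm (Fin n)) : rthSmallest r (a ∘ σ) ≤ rthSmallest r a := by
  obtain ⟨s, hs, h⟩ := exists_le_rthSmallest hrn a
  refine rthSmallest_le _ (s := s.map σ.symm.toEmbedding) (by simpa using hs) fun j hj => ?_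
  obtain ⟨i, hi, rfl⟩ := Finset.mem_map.1 hj
  simpa using h i hi

lemma rthSmallest_comp_perm {n r : ℕ} (hrn : r ≤ n) (a : Fin n → unitInterval)
    (σ : Equiv.Perm (Fin n)) : rthSmallest r (a ∘ σ) = rthSmallest r a := by
  refine (rthSmallest_comp_perm_le hrn a σ).antisymm ?_
  simpa [Function.comp_assoc] using rthSmallest_comp_perm_le hrn (a ∘ σ) σ.symm

/-- A time cutoff equal to `1` for `0 < a ≤ v` and to `0` for `v = 0`, `a ≠ 0`. -/
noncomputable def timeCutoff (v a : unitInterval) : unitInterval :=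
  Set.projIcc 0 1 zero_le_one (2 * (v : ℝ) / a - 1)

lemma timeCutoff_zero_left (a : unitInterval) : timeCutoff 0 a = 0 := by
  refine Set.projIcc_of_le_left _ ?_
  simp

lemma timeCutoff_eq_one {v a : unitInterval} (ha : a ≠ 0) (h : a ≤ v) : timeCutoff v a = 1 := by
  refine Set.projIcc_of_right_le _ ?_
  have ha' : (0 : ℝ) < a := unitInterval.pos_iff_ne_zero.2 ha
  have h' : (a : ℝ) ≤ v := h
  rw [le_sub_iff_add_le, le_div_iff₀ ha']
  linarith

lemma ContinuousAt.timeCutoff {Y : Type*} [TopologicalSpace Y] {v a : Y → unitInterval} {y : Y}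
    (hv : ContinuousAt v y) (ha : ContinuousAt a y) (h : a y ≠ 0) :
    ContinuousAt (fun z => timeCutoff (v z) (a z)) y := by
  have h' : (a y : ℝ) ≠ 0 := unitInterval.coe_ne_zero.2 h
  have hc : ContinuousAt (fun z => 2 * (v z : ℝ) / a z - 1) y := by
    fun_prop (disch := assumption)
  exact continuous_projIcc.continuousAt.comp hc

/-- If `(X, A)` is an NDR-pair and `1 ≤ r ≤ n`, then `(Xⁿ, F_r Xⁿ)` is an NDR-pair, and a
representation can be chosen `Σ_n`-equivariantly: `U` is invariant under permutations of
the coordinates and `H` is equivariant for the coordinate-permutation action of the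
symmetric group `Σ_n`. -/
theorem ndr_pair_fat_wedge
    {X : Type*} [TopologicalSpace X] (A : Set X)
    (h₀ : unitInterval × X → X) (u₀ : X → ℝ) (hrep : RepresentsNDR A h₀ u₀)
    (n r : ℕ) (hr : 1 ≤ r) (hrn : r ≤ n) :
    ∃ (H : unitInterval × (Fin n → X) → Fin n → X) (U : (Fin n → X) → ℝ),
      RepresentsNDR (FatWedge A n r) H U ∧
      (∀ σ : Equiv.Perm (Fin n), ∀ x : Fin n → X, U (x ∘ σ) = U x) ∧
      (∀ σ : Equiv.Perm (Fin n), ∀ (t : unitInterval) (x : Fin n → X),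
        H (t, x ∘ σ) = H (t, x) ∘ σ) := by
  obtain ⟨hu, hh, hI, rfl, h0, hA, h1⟩ := hrep
  let u : X → unitInterval := fun x => ⟨u₀ x, hI x⟩
  have hu' : Continuous u := hu.subtype_mk _
  have hmem : ∀ x, x ∈ u₀ ⁻¹' {0} ↔ u x = 0 := fun x => by
    simp [u, Subtype.ext_iff]
  let v : (Fin n → X) → unitInterval := fun x => rthSmallest r (u ∘ x)
  have hv : Continuous v := (continuous_rthSmallest r).comp
    (continuous_pi fun j => hu'.comp (continuous_apply j))
  have hvσ : ∀ (σ : Equiv.Perm (Fin n)) x, v (x ∘ σ) = v x := fun σ x =>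
    rthSmallest_comp_perm hrn (u ∘ x) σ
  have hwedge : ∀ x, x ∈ FatWedge (u₀ ⁻¹' {0}) n r ↔ v x = 0 := by
    intro x
    constructor
    · rintro ⟨s, hs, h⟩
      exact le_antisymm (rthSmallest_le _ hs fun j hj => ((hmem _).1 (h j hj)).le) bot_le
    · intro hx
      obtain ⟨s, hs, h⟩ := exists_le_rthSmallest hrn (u ∘ x)
      exact ⟨s, hs, fun j hj => (hmem _).2 (le_antisymm ((h j hj).trans hx.le) bot_le)⟩
  refine ⟨fun p j => h₀ (p.1 * timeCutoff (v p.2) (u (p.2 j)), p.2 j), fun x => v x,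
    ⟨continuous_subtype_val.comp hv, ?_, fun x => (v x).2, ?_, ?_, ?_, ?_⟩, ?_, ?_⟩
  · refine continuous_pi fun j => continuous_homotopy_reparam hh hA (by fun_prop) fun p hp => ?_
    have hvp : ContinuousAt (fun q : unitInterval × (Fin n → X) => v q.2) p := by fun_prop
    have hup : ContinuousAt (fun q : unitInterval × (Fin n → X) => u (q.2 j)) p := by fun_prop
    have hcut := hvp.timeCutoff hup (mt (hmem _).2 hp)
    exact (continuousAt_fst (p := p)).mul hcut
  · ext x
    exact (hwedge x).trans Subtype.ext_iff
  · intro x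
    funext j
    simp [h0]
  · intro t x hx
    funext j
    simp [(hwedge x).1 hx, timeCutoff_zero_left, h0]
  · intro x hx
    obtain ⟨s, hs, h⟩ := exists_le_rthSmallest hrn (u ∘ x)
    refine ⟨s, hs, fun j hj => ?_⟩
    by_cases hj0 : u (x j) = 0
    · have hxA := (hmem _).2 hj0
      simp only [hA _ _ hxA]
      exact hxA
    · have hle : u (x j) ≤ v x := h j hj
      simp only [timeCutoff_eq_one hj0 hle, mul_one]
      exact h1 _ (lt_of_le_of_lt (show (u (x j) : ℝ) ≤ v x from hle) hx)
  · intro σ x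
    simp only [hvσ]
  · intro σ t x
    funext j
    simp only [hvσ, Function.comp_apply]
end

section
/- Let G be a topologically closed subgroup of GL_m(ℂ). Then there exist continuous maps u : G → [0,1] and h : [0,1] × G → G representing (G, {1_G}) as an NDR-pair with the additional property that for every g ∈ G with g ≠ 1_G and every t ∈ [0,1), the centralizer of h(t, g) in G equals the centralizer of g in G. -/
open Filter Topology

namespace NormedSpace

section BanachAlgebra

variable {A : Type*} [NormedRing A]

theorem norm_commutator_pow_succ_le (c X : A) (n : ℕ) :
    ‖c * X ^ (n + 1) - X ^ (n + 1) * c‖ ≤ (n + 1) * ‖X‖ ^ n * ‖c * X - X * c‖ := by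
  induction n with
  | zero => simp
  | succ n ih =>
    have key : c * X ^ (n + 2) - X ^ (n + 2) * c =
        (c * X ^ (n + 1) - X ^ (n + 1) * c) * X + X ^ (n + 1) * (c * X - X * c) := by
      rw [pow_succ X (n + 1)]; noncomm_ring
    rw [key]
    calc _ ≤ ‖c * X ^ (n + 1) - X ^ (n + 1) * c‖ * ‖X‖ + ‖X‖ ^ (n + 1) * ‖c * X - X * c‖ := by
          refine (norm_add_le _ _).trans (add_le_add (norm_mul_le _ _) ?_)
          refine (norm_mul_le _ _).trans ?_
          gcongr
          exact norm_pow_le' X n.succ_pos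
      _ ≤ ((n + 1) * ‖X‖ ^ n * ‖c * X - X * c‖) * ‖X‖ + ‖X‖ ^ (n + 1) * ‖c * X - X * c‖ := by
          gcongr
      _ = _ := by push_cast; ring

variable [NormedAlgebra ℝ A] [CompleteSpace A]

theorem continuous_exp_of_real : Continuous (exp : A → A) :=
  letI := NormedAlgebra.restrictScalars ℚ ℝ A
  exp_continuous

theorem exp_add_of_commute_of_real {x y : A} (h : Commute x y) : exp (x + y) = exp x * exp y :=
  letI := NormedAlgebra.restrictScalars ℚ ℝ A
  exp_add_of_commute h

theorem exp_mul_exp_neg (x : A) : exp x * exp (-x) = 1 := by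
  rw [← exp_add_of_commute_of_real (Commute.refl x).neg_right, add_neg_cancel, exp_zero]

theorem exp_neg_mul_exp (x : A) : exp (-x) * exp x = 1 := by
  rw [← exp_add_of_commute_of_real (Commute.refl x).neg_left, neg_add_cancel, exp_zero]

/-- An element commuting with the exponential of a small `X` commutes with `X`. -/
theorem commute_of_commute_exp {c X : A} (hX : ‖X‖ ≤ 1 / 4) (h : Commute c (exp X)) :
    Commute c X := by
  set a : ℕ → A := fun n => ((n.factorial : ℝ)⁻¹) • (c * X ^ n - X ^ n * c) with ha
  have hs : HasSum a 0 := by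
    have h1 := exp_series_hasSum_exp' (𝕂 := ℝ) X
    have h2 := (h1.mul_left c).sub (h1.mul_right c)
    rw [h.eq, sub_self] at h2
    simpa only [mul_smul_comm, smul_mul_assoc, ← smul_sub] using h2
  set K := ‖c * X - X * c‖ with hK
  have hb : ∀ n, ‖a (n + 2)‖ ≤ (K / 4) * (1 / 4) ^ n := by
    intro n
    have h1 := norm_commutator_pow_succ_le c X (n + 1)
    have hf : ((n + 2).factorial : ℝ)⁻¹ * (n + 2) ≤ 1 := by
      rw [Nat.factorial_succ]
      have : (1 : ℝ) ≤ (n + 1).factorial := by exact_mod_cast Nat.factorial_pos _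
      push_cast
      rw [inv_mul_le_iff₀ (by positivity)]
      nlinarith
    rw [ha, norm_smul, norm_inv, Real.norm_natCast]
    push_cast at h1
    calc _ ≤ ((n + 2).factorial : ℝ)⁻¹ * ((n + 1 + 1) * ‖X‖ ^ (n + 1) * K) := by gcongr
      _ = (((n + 2).factorial : ℝ)⁻¹ * (n + 2)) * (‖X‖ ^ (n + 1) * K) := by ring
      _ ≤ 1 * ((1 / 4) ^ (n + 1) * K) := by gcongr
      _ = _ := by ring
  have hg : HasSum (fun n : ℕ => (K / 4) * (1 / 4 : ℝ) ^ n) ((K / 4) * (1 - 1 / 4)⁻¹) :=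
    (hasSum_geometric_of_lt_one (by norm_num) (by norm_num)).mul_left _
  have htail : HasSum (fun n => a (n + 2)) (-(c * X - X * c)) := by
    have := (hasSum_nat_add_iff' 2).2 hs
    simpa [Finset.sum_range_succ, ha] using this
  have hle : K ≤ (K / 4) * (1 - 1 / 4)⁻¹ := by
    have := htail.norm_le_of_bounded hg hb
    rwa [norm_neg] at this
  have hK0 : K = 0 := by
    have : 0 ≤ K := norm_nonneg _
    norm_num at hle
    linarith
  exact sub_eq_zero.1 (norm_eq_zero.1 hK0)

theorem commute_exp_smul_iff {c X : A} (hX : ‖X‖ ≤ 1 / 4) {s : ℝ} (hs : 0 < s) (hs1 : s ≤ 1) :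
    Commute c (exp (s • X)) ↔ Commute c (exp X) := by
  have hsX : ‖s • X‖ ≤ 1 / 4 := by
    rw [norm_smul, Real.norm_of_nonneg hs.le]
    nlinarith [norm_nonneg X]
  constructor
  · intro h
    have := (commute_of_commute_exp hsX h).smul_right s⁻¹
    rw [inv_smul_smul₀ hs.ne'] at this
    exact this.exp_right
  · intro h
    exact ((commute_of_commute_exp hX h).smul_right s).exp_right

theorem hasStrictFDerivAt_exp_zero_refl :
    HasStrictFDerivAt (exp : A → A) ((ContinuousLinearEquiv.refl ℝ A : A ≃L[ℝ] A) : A →L[ℝ] A) 0 :=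
  hasStrictFDerivAt_exp_zero

variable (A) in
/-- The exponential as a homeomorphism from a neighbourhood of `0` to a neighbourhood of `1`. -/
noncomputable def expOpenPartialHomeomorph : OpenPartialHomeomorph A A :=
  (hasStrictFDerivAt_exp_zero_refl (A := A)).toOpenPartialHomeomorph exp

theorem expOpenPartialHomeomorph_apply (X : A) : expOpenPartialHomeomorph A X = exp X := rfl

theorem zero_mem_expOpenPartialHomeomorph_source :
    (0 : A) ∈ (expOpenPartialHomeomorph A).source :=
  (hasStrictFDerivAt_exp_zero_refl (A := A)).mem_toOpenPartialHomeomorph_source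

theorem one_mem_expOpenPartialHomeomorph_target :
    (1 : A) ∈ (expOpenPartialHomeomorph A).target := by
  have := (expOpenPartialHomeomorph A).map_source zero_mem_expOpenPartialHomeomorph_source
  rwa [expOpenPartialHomeomorph_apply, exp_zero] at this

theorem expOpenPartialHomeomorph_symm_one : (expOpenPartialHomeomorph A).symm (1 : A) = 0 := by
  have := (expOpenPartialHomeomorph A).left_inv zero_mem_expOpenPartialHomeomorph_source
  rwa [expOpenPartialHomeomorph_apply, exp_zero] at this

theorem hasFDerivAt_expOpenPartialHomeomorph_symm :
    HasFDerivAt (expOpenPartialHomeomorph A).symm (ContinuousLinearMap.id ℝ A) 1 := by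
  have := (hasStrictFDerivAt_exp_zero_refl (A := A)).to_localInverse.hasFDerivAt
  rw [exp_zero] at this
  exact this

theorem eventually_expOpenPartialHomeomorph_symm_exp :
    ∀ᶠ X in 𝓝 (0 : A), (expOpenPartialHomeomorph A).symm (exp X) = X := by
  filter_upwards [(expOpenPartialHomeomorph A).open_source.mem_nhds
    zero_mem_expOpenPartialHomeomorph_source] with X hX
  exact (expOpenPartialHomeomorph A).left_inv hX

theorem eventually_exp_expOpenPartialHomeomorph_symm :
    ∀ᶠ g in 𝓝 (1 : A), exp ((expOpenPartialHomeomorph A).symm g) = g := by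
  filter_upwards [(expOpenPartialHomeomorph A).open_target.mem_nhds
    one_mem_expOpenPartialHomeomorph_target] with g hg
  exact (expOpenPartialHomeomorph A).right_inv hg

end BanachAlgebra

end NormedSpace

open NormedSpace

namespace Subgroup

section BanachAlgebra

variable {A : Type*} [NormedRing A] (H : Subgroup Aˣ)

/-- The elements of a ring which are units belonging to a given subgroup. -/
def valSet : Set A := Units.val '' (H : Set Aˣ)

variable {H}

theorem one_mem_valSet : (1 : A) ∈ H.valSet := ⟨1, H.one_mem, rfl⟩

theorem mul_mem_valSet {a b : A} (ha : a ∈ H.valSet) (hb : b ∈ H.valSet) : a * b ∈ H.valSet := by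
  obtain ⟨u, hu, rfl⟩ := ha
  obtain ⟨v, hv, rfl⟩ := hb
  exact ⟨u * v, H.mul_mem hu hv, rfl⟩

variable [NormedAlgebra ℝ A] [CompleteSpace A]

theorem exp_neg_mem_valSet {X : A} (h : exp X ∈ H.valSet) : exp (-X) ∈ H.valSet := by
  obtain ⟨v, hv, hvX⟩ := h
  refine ⟨v⁻¹, H.inv_mem hv, ?_⟩
  rw [Units.inv_eq_of_mul_eq_one_right]
  rw [hvX, exp_mul_exp_neg]

theorem exp_natCast_smul_mem_valSet {X : A} (h : exp X ∈ H.valSet) (n : ℕ) :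
    exp ((n : ℝ) • X) ∈ H.valSet := by
  induction n with
  | zero => simpa using one_mem_valSet
  | succ n ih =>
    rw [Nat.cast_succ, add_smul, one_smul,
      exp_add_of_commute_of_real ((Commute.refl X).smul_left _)]
    exact mul_mem_valSet ih h

theorem exp_intCast_smul_mem_valSet {X : A} (h : exp X ∈ H.valSet) (z : ℤ) :
    exp ((z : ℝ) • X) ∈ H.valSet := by
  obtain ⟨n, rfl | rfl⟩ := z.eq_nat_or_neg
  · exact_mod_cast exp_natCast_smul_mem_valSet h n
  · have := exp_neg_mem_valSet (exp_natCast_smul_mem_valSet h n)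
    simpa using this

theorem exp_mem_valSet_of_tendsto (hH : IsClosed (H : Set Aˣ)) {ι : Type*} {l : Filter ι} [l.NeBot]
    {f : ι → A} {X : A} (hf : Tendsto f l (𝓝 (exp X))) (hfH : ∀ᶠ i in l, f i ∈ H.valSet) :
    exp X ∈ H.valSet := by
  let v : Aˣ := ⟨exp X, exp (-X), exp_mul_exp_neg X, exp_neg_mul_exp X⟩
  have hex : ∀ i, ∃ w : Aˣ, f i ∈ H.valSet → w ∈ H ∧ (w : A) = f i := fun i => by
    by_cases hi : f i ∈ H.valSet
    · obtain ⟨w, hw, hwi⟩ := hi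
      exact ⟨w, fun _ => ⟨hw, hwi⟩⟩
    · exact ⟨1, fun h => absurd h hi⟩
  choose w hw using hex
  have hwv : Tendsto w l (𝓝 v) := by
    rw [Units.isOpenEmbedding_val.isEmbedding.tendsto_nhds_iff]
    refine hf.congr' ?_
    filter_upwards [hfH] with i hi using (hw i hi).2.symm
  exact ⟨v, hH.mem_of_tendsto hwv (hfH.mono fun i hi => (hw i hi).1), rfl⟩

theorem exp_smul_mem_valSet_of_tendsto (hH : IsClosed (H : Set Aˣ)) {ι : Type*} {l : Filter ι}
    [l.NeBot] {Y : ι → A} {r : ι → ℝ} {X : A} (hY : Tendsto Y l (𝓝 0))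
    (hYH : ∀ᶠ i in l, exp (Y i) ∈ H.valSet) (hr : Tendsto (fun i => r i • Y i) l (𝓝 X)) (t : ℝ) :
    exp (t • X) ∈ H.valSet := by
  have hfr : Tendsto (fun i => Int.fract (t * r i) • Y i) l (𝓝 0) := by
    refine squeeze_zero_norm (fun i => ?_) (tendsto_zero_iff_norm_tendsto_zero.1 hY)
    rw [norm_smul, Real.norm_of_nonneg (Int.fract_nonneg _)]
    exact mul_le_of_le_one_left (norm_nonneg _) (Int.fract_lt_one _).le
  have hfl : Tendsto (fun i => ((⌊t * r i⌋ : ℤ) : ℝ) • Y i) l (𝓝 (t • X)) := by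
    have := (hr.const_smul t).sub hfr
    rw [sub_zero] at this
    refine this.congr fun i => ?_
    rw [smul_smul, ← sub_smul, Int.self_sub_fract]
  refine exp_mem_valSet_of_tendsto hH ((continuous_exp_of_real.tendsto _).comp hfl) ?_
  filter_upwards [hYH] with i hi using exp_intCast_smul_mem_valSet hi _

/-- The Lie algebra of a closed subgroup of the units of a Banach algebra, as a real subspace. -/
def lieSubmodule (H : Subgroup Aˣ) (hH : IsClosed (H : Set Aˣ)) : Submodule ℝ A where
  carrier := {X | ∀ t : ℝ, exp (t • X) ∈ H.valSet}
  zero_mem' t := by simpa using one_mem_valSet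
  smul_mem' s X hX t := by
    rw [smul_smul]
    exact hX _
  add_mem' {X Y} hX hY := by
    have hexp : ∀ Z : A, HasDerivAt (fun t : ℝ => exp (t • Z)) Z 0 := fun Z => by
      simpa using hasDerivAt_exp_smul_const (𝕂 := ℝ) Z (0 : ℝ)
    have hprod : HasDerivAt (fun t : ℝ => exp (t • X) * exp (t • Y)) (X + Y) 0 := by
      simpa using (hexp X).fun_mul (hexp Y)
    have hlog : HasDerivAt (fun t : ℝ => (expOpenPartialHomeomorph A).symm
        (exp (t • X) * exp (t • Y))) (X + Y) 0 := by
      refine HasFDerivAt.comp_hasDerivAt (l' := ContinuousLinearMap.id ℝ A) (0 : ℝ) ?_ hprod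
      simpa using hasFDerivAt_expOpenPartialHomeomorph_symm (A := A)
    have h0 : Tendsto (fun t : ℝ => exp (t • X) * exp (t • Y)) (𝓝[≠] 0) (𝓝 1) := by
      have := hprod.continuousAt.tendsto.mono_left (nhdsWithin_le_nhds (s := {0}ᶜ))
      simpa using this
    refine exp_smul_mem_valSet_of_tendsto hH (l := 𝓝[≠] (0 : ℝ)) (r := fun t => t⁻¹)
      (Y := fun t => (expOpenPartialHomeomorph A).symm (exp (t • X) * exp (t • Y))) ?_ ?_ ?_
    · have := hlog.continuousAt.tendsto.mono_left (nhdsWithin_le_nhds (s := {0}ᶜ))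
      simpa [expOpenPartialHomeomorph_symm_one] using this
    · filter_upwards [h0.eventually eventually_exp_expOpenPartialHomeomorph_symm] with t ht
      rw [ht]
      exact mul_mem_valSet (hX t) (hY t)
    · simpa [expOpenPartialHomeomorph_symm_one] using hlog.tendsto_slope_zero

theorem exp_mem_valSet_of_mem_lieSubmodule {hH : IsClosed (H : Set Aˣ)} {X : A}
    (hX : X ∈ H.lieSubmodule hH) : exp X ∈ H.valSet := by
  simpa using hX 1

theorem eventually_eq_zero_of_exp_mem_valSet [FiniteDimensional ℝ A] (hH : IsClosed (H : Set Aˣ))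
    {W : Submodule ℝ A} (hW : Disjoint (H.lieSubmodule hH) W) :
    ∀ᶠ Y in 𝓝 (0 : A), Y ∈ W → exp Y ∈ H.valSet → Y = 0 := by
  have : ProperSpace A := FiniteDimensional.proper ℝ A
  by_contra hcon
  have hfreq : ∃ᶠ Y in 𝓝 (0 : A), Y ∈ W ∧ exp Y ∈ H.valSet ∧ Y ≠ 0 := by
    intro h
    exact hcon (h.mono fun Y hY h1 h2 => by_contra fun h3 => hY ⟨h1, h2, h3⟩)
  have : (𝓝 (0 : A) ⊓ 𝓟 {Y | Y ∈ W ∧ exp Y ∈ H.valSet ∧ Y ≠ 0}).NeBot :=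
    frequently_mem_iff_neBot.1 hfreq
  set l := Ultrafilter.of (𝓝 (0 : A) ⊓ 𝓟 {Y | Y ∈ W ∧ exp Y ∈ H.valSet ∧ Y ≠ 0})
  have hl := Ultrafilter.of_le (𝓝 (0 : A) ⊓ 𝓟 {Y | Y ∈ W ∧ exp Y ∈ H.valSet ∧ Y ≠ 0})
  have hl0 : Tendsto (fun Y : A => Y) l (𝓝 0) := hl.trans inf_le_left
  have hlS : ∀ᶠ Y in (l : Filter A), Y ∈ W ∧ exp Y ∈ H.valSet ∧ Y ≠ 0 :=
    le_principal_iff.1 (hl.trans inf_le_right)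
  have hsph : ∀ᶠ Y in (l : Filter A), ‖Y‖⁻¹ • Y ∈ Metric.sphere (0 : A) 1 := by
    filter_upwards [hlS] with Y hY
    simp [norm_smul, inv_mul_cancel₀ (norm_ne_zero_iff.2 hY.2.2)]
  obtain ⟨Z, hZ, hlZ⟩ := (isCompact_sphere (0 : A) 1).ultrafilter_le_nhds
    (l.map fun Y => ‖Y‖⁻¹ • Y) (le_principal_iff.2 hsph)
  have hZ1 : Z ∈ H.lieSubmodule hH :=
    exp_smul_mem_valSet_of_tendsto hH hl0 (hlS.mono fun Y hY => hY.2.1) hlZ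
  have hZ2 : Z ∈ W := W.closed_of_finiteDimensional.mem_of_tendsto hlZ
    (hlS.mono fun Y hY => W.smul_mem _ hY.1)
  have hZ0 : Z = 0 := Submodule.disjoint_def.1 hW Z hZ1 hZ2
  simp [hZ0] at hZ

/-- Near `0`, the exponential only meets a closed subgroup along its Lie algebra. -/
theorem eventually_mem_lieSubmodule_of_exp_mem_valSet [FiniteDimensional ℝ A]
    (hH : IsClosed (H : Set Aˣ)) :
    ∀ᶠ X in 𝓝 (0 : A), exp X ∈ H.valSet → X ∈ H.lieSubmodule hH := by
  obtain ⟨W, hW⟩ := Submodule.exists_isCompl (H.lieSubmodule hH)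
  let P : A →L[ℝ] A := LinearMap.toContinuousLinearMap ((H.lieSubmodule hH).projection W hW)
  have hP : ∀ X, P X ∈ H.lieSubmodule hH := fun X => Submodule.projection_apply_mem hW X
  have hQ : ∀ X, X - P X ∈ W := fun X => Submodule.sub_projection_mem hW X
  have hP0 : Tendsto P (𝓝 0) (𝓝 0) := by simpa using P.continuous.tendsto 0
  have hQ0 : Tendsto (fun X => X - P X) (𝓝 0) (𝓝 0) := by
    have hc : Continuous fun X => X - P X := by fun_prop
    simpa using hc.tendsto 0
  have hΦ : HasStrictFDerivAt (fun X => exp (P X) * exp (X - P X))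
      ((ContinuousLinearEquiv.refl ℝ A : A ≃L[ℝ] A) : A →L[ℝ] A) 0 := by
    have hexp : ∀ T : A →L[ℝ] A, HasStrictFDerivAt (fun X => exp (T X)) T 0 := fun T => by
      have h1 : HasStrictFDerivAt (exp : A → A) (1 : A →L[ℝ] A) (T 0) := by
        rw [map_zero]
        exact hasStrictFDerivAt_exp_zero
      exact h1.comp 0 T.hasStrictFDerivAt
    have := (hexp P).mul' (hexp (ContinuousLinearMap.id ℝ A - P))
    refine this.congr_fderiv ?_
    ext X
    simp
  have hmap := hΦ.map_nhds_eq_of_equiv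
  simp only [map_zero, sub_zero, exp_zero, mul_one] at hmap
  have hlog : ∀ᶠ g in 𝓝 (1 : A), g ∈ H.valSet →
      (expOpenPartialHomeomorph A).symm g ∈ H.lieSubmodule hH := by
    rw [← hmap, eventually_map]
    filter_upwards [hQ0.eventually (eventually_eq_zero_of_exp_mem_valSet hH hW.disjoint),
      hP0.eventually eventually_expOpenPartialHomeomorph_symm_exp] with X hX1 hX2 hX
    have hmem : exp (X - P X) ∈ H.valSet := by
      have h1 := mul_mem_valSet
        (exp_neg_mem_valSet (exp_mem_valSet_of_mem_lieSubmodule (hP X))) hX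
      rwa [← mul_assoc, exp_neg_mul_exp, one_mul] at h1
    rw [hX1 (hQ X) hmem, exp_zero, mul_one, hX2]
    exact hP X
  have hexp1 : Tendsto (exp : A → A) (𝓝 0) (𝓝 1) := by
    simpa using continuous_exp_of_real.tendsto (0 : A)
  filter_upwards [hexp1.eventually hlog, eventually_expOpenPartialHomeomorph_symm_exp]
    with X hX1 hX2 hX
  rw [← hX2]
  exact hX1 hX

end BanachAlgebra

end Subgroup

open Classical in
/-- Transporting a function supported in a compact subset of the source of a partial homeomorphism
to the target, with extension by zero, gives a continuous function. -/
theorem OpenPartialHomeomorph.continuous_extend_symm {X Y E : Type*} [TopologicalSpace X]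
    [TopologicalSpace Y] [T2Space Y] [TopologicalSpace E] [Zero E] (e : OpenPartialHomeomorph X Y)
    {f : X → E} (hf : Continuous f) {K : Set X} (hK : IsCompact K) (hKe : K ⊆ e.source)
    (hfK : ∀ x ∉ K, f x = 0) :
    Continuous fun y => if y ∈ e.target then f (e.symm y) else 0 := by
  rw [continuous_iff_continuousAt]
  intro y
  by_cases hy : y ∈ e.target
  · have : ContinuousAt (fun y => f (e.symm y)) y :=
      hf.continuousAt.comp (e.continuousAt_symm hy)
    refine this.congr ?_
    filter_upwards [e.open_target.mem_nhds hy] with z hz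
    simp [hz]
  · have hclosed : IsClosed (e '' K) := (hK.image_of_continuousOn (e.continuousOn.mono hKe)).isClosed
    have hyK : y ∉ e '' K := by
      rintro ⟨x, hx, rfl⟩
      exact hy (e.map_source (hKe hx))
    refine (continuousAt_const (y := (0 : E))).congr ?_
    filter_upwards [hclosed.isOpen_compl.mem_nhds hyK] with z hz
    split_ifs with hzt
    · refine (hfK _ fun hzK => hz ⟨_, hzK, e.right_inv hzt⟩).symm
    · rfl

open Classical in
theorem Subgroup.exists_representsNDR_of_isClosed {A : Type*} [NormedRing A] [NormedAlgebra ℝ A]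
    [FiniteDimensional ℝ A] (H : Subgroup Aˣ) (hH : IsClosed (H : Set Aˣ)) :
    ∃ (h : unitInterval × H → H) (u : H → ℝ),
      RepresentsNDR ({1} : Set H) h u ∧
      ∀ g : H, g ≠ 1 → ∀ t : unitInterval, (t : ℝ) < 1 →
        ∀ c : H, (c * h (t, g) = h (t, g) * c ↔ c * g = g * c) := by
  have : ProperSpace A := FiniteDimensional.proper ℝ A
  have : CompleteSpace A := FiniteDimensional.complete ℝ A
  set e := expOpenPartialHomeomorph A with he
  obtain ⟨ε, hε, hball⟩ := Metric.eventually_nhds_iff_ball.1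
    ((eventually_mem_lieSubmodule_of_exp_mem_valSet hH).and
      (e.open_source.eventually_mem zero_mem_expOpenPartialHomeomorph_source))
  obtain ⟨δ, hδ, hδε, hδ4⟩ : ∃ δ > 0, 2 * δ < ε ∧ 2 * δ ≤ 1 / 4 :=
    ⟨min (ε / 4) (1 / 8), by positivity, by linarith [min_le_left (ε / 4) (1 / 8)],
      by linarith [min_le_right (ε / 4) (1 / 8)]⟩
  have hlie : ∀ X : A, ‖X‖ ≤ 2 * δ → exp X ∈ H.valSet → X ∈ H.lieSubmodule hH := fun X hX =>
    (hball X (mem_ball_zero_iff.2 (hX.trans_lt hδε))).1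
  have hsrc : Metric.closedBall (0 : A) (2 * δ) ⊆ e.source := fun X hX =>
    (hball X (Metric.closedBall_subset_ball hδε hX)).2
  let χ : A → ℝ := fun X => max 0 (min 1 (2 - ‖X‖ / δ))
  have hχc : Continuous χ := by fun_prop
  have hχ0 : ∀ X, 0 ≤ χ X := fun X => le_max_left _ _
  have hχ1 : ∀ X, χ X ≤ 1 := fun X => max_le zero_le_one (min_le_left _ _)
  have hχ_eq_one : ∀ X, ‖X‖ ≤ δ → χ X = 1 := fun X hX => by
    have : ‖X‖ / δ ≤ 1 := (div_le_one hδ).2 hX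
    simp only [χ]
    rw [min_eq_left (by linarith), max_eq_right zero_le_one]
  have hχ_eq_zero : ∀ X, 2 * δ ≤ ‖X‖ → χ X = 0 := fun X hX => by
    have : 2 ≤ ‖X‖ / δ := (le_div_iff₀ hδ).2 hX
    simp only [χ]
    rw [max_eq_left (min_le_of_right_le (by linarith))]
  have hψc := e.continuous_extend_symm (f := fun X => χ X • X) (by fun_prop)
    (isCompact_closedBall (0 : A) (2 * δ)) hsrc fun X hX => by
      rw [mem_closedBall_zero_iff, not_le] at hX
      simp [hχ_eq_zero X hX.le]
  have hvc := e.continuous_extend_symm (f := fun X => max 0 (1 - ‖X‖ / δ)) (by fun_prop)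
    (isCompact_closedBall (0 : A) (2 * δ)) hsrc fun X hX => by
      rw [mem_closedBall_zero_iff, not_le] at hX
      refine max_eq_left ?_
      have : 2 ≤ ‖X‖ / δ := (le_div_iff₀ hδ).2 hX.le
      linarith
  set ψ : A → A := fun g => if g ∈ e.target then χ (e.symm g) • e.symm g else 0 with hψ
  set v : A → ℝ := fun g => if g ∈ e.target then max 0 (1 - ‖e.symm g‖ / δ) else 0 with hv
  have hcases : ∀ g : H, (ψ (g : Aˣ) = 0) ∨ ∃ X ∈ H.lieSubmodule hH, ‖X‖ ≤ 1 / 4 ∧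
      exp X = (g : Aˣ) ∧ ψ (g : Aˣ) = χ X • X := by
    intro g
    by_cases hg : ((g : Aˣ) : A) ∈ e.target
    · by_cases hX : ‖e.symm ((g : Aˣ) : A)‖ ≤ 2 * δ
      · have hexp : exp (e.symm ((g : Aˣ) : A)) = (g : Aˣ) := e.right_inv hg
        exact Or.inr ⟨_, hlie _ hX (hexp.symm ▸ ⟨g, g.2, rfl⟩), hX.trans hδ4, hexp, by simp [hψ, hg]⟩
      · exact Or.inl (by simp [hψ, hg, hχ_eq_zero _ (not_le.1 hX).le])
    · exact Or.inl (by simp [hψ, hg])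
  have hmul : ∀ (X : A) (t : ℝ), exp (-(t • χ X • X)) * exp X = exp ((1 - t * χ X) • X) := by
    intro X t
    rw [← exp_add_of_commute_of_real
      (((Commute.refl X).smul_left _).smul_left _).neg_left, sub_smul, one_smul, smul_smul]
    congr 1
    abel
  have hex : ∀ p : unitInterval × H, ∃ x : H,
      ((x : Aˣ) : A) = exp (-((p.1 : ℝ) • ψ (p.2 : Aˣ))) * (p.2 : Aˣ) := by
    rintro ⟨t, g⟩
    rcases hcases g with hg | ⟨X, hX, -, hXg, hψX⟩
    · exact ⟨g, by simp [hg]⟩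
    · obtain ⟨x, hx, hxX⟩ := hX (1 - t * χ X)
      refine ⟨⟨x, hx⟩, ?_⟩
      simp only
      rw [hψX, ← hXg, hmul]
      exact hxX
  choose h hh using hex
  have hinj : ∀ x y : H, ((x : Aˣ) : A) = (y : Aˣ) → x = y := fun x y hxy =>
    Subtype.ext (Units.ext hxy)
  have hval : Continuous fun x : H => ((x : Aˣ) : A) :=
    Units.continuous_val.comp continuous_subtype_val
  have hψ1 : ψ 1 = 0 := by
    simp [hψ, he, expOpenPartialHomeomorph_symm_one]
  refine ⟨h, fun g => 1 - v (g : Aˣ), ⟨?_, ?_, ?_, ?_, ?_, ?_, ?_⟩, ?_⟩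
  · exact continuous_const.sub (hvc.comp hval)
  · rw [continuous_induced_rng, Units.isOpenEmbedding_val.isEmbedding.continuous_iff]
    have : Continuous fun p : unitInterval × H =>
        exp (-((p.1 : ℝ) • ψ (p.2 : Aˣ))) * ((p.2 : Aˣ) : A) :=
      (continuous_exp_of_real.comp ((continuous_subtype_val.comp continuous_fst).smul
        (hψc.comp (hval.comp continuous_snd))).neg).mul (hval.comp continuous_snd)
    exact this.congr fun p => (hh p).symm
  · intro g
    have h0 : 0 ≤ v (g : Aˣ) := by
      simp only [hv]
      split_ifs
      exacts [le_max_left _ _, le_rfl]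
    have h1 : v (g : Aˣ) ≤ 1 := by
      simp only [hv]
      split_ifs
      exacts [max_le zero_le_one (sub_le_self _ (by positivity)), zero_le_one]
    exact ⟨by linarith, by linarith⟩
  · ext g
    simp only [Set.mem_singleton_iff, Set.mem_preimage]
    constructor
    · rintro rfl
      simp [hv, he, expOpenPartialHomeomorph_symm_one, one_mem_expOpenPartialHomeomorph_target]
    · intro hg
      by_cases hgt : ((g : Aˣ) : A) ∈ e.target
      · simp only [hv, hgt, if_true] at hg
        have hmax : max 0 (1 - ‖e.symm ((g : Aˣ) : A)‖ / δ) = 1 := by linarith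
        have hle : ‖e.symm ((g : Aˣ) : A)‖ / δ ≤ 0 := by
          rcases max_choice 0 (1 - ‖e.symm ((g : Aˣ) : A)‖ / δ) with hc | hc <;> linarith
        have hnorm : ‖e.symm ((g : Aˣ) : A)‖ ≤ 0 := by
          simpa using (div_le_iff₀ hδ).1 hle
        have hexp : exp (e.symm ((g : Aˣ) : A)) = (g : Aˣ) := e.right_inv hgt
        refine hinj _ _ ?_
        rw [← hexp, norm_le_zero_iff.1 hnorm, exp_zero]
        rfl
      · simp [hv, hgt] at hg
  · intro g
    exact hinj _ _ (by simp [hh])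
  · rintro t g rfl
    exact hinj _ _ (by simp [hh, hψ1])
  · intro g hg
    by_cases hgt : ((g : Aˣ) : A) ∈ e.target
    · simp only [hv, hgt, if_true] at hg
      have hX : ‖e.symm ((g : Aˣ) : A)‖ ≤ δ := by
        by_contra hcon
        have : 1 ≤ ‖e.symm ((g : Aˣ) : A)‖ / δ := (le_div_iff₀ hδ).2 (by linarith)
        rw [max_eq_left (by linarith)] at hg
        linarith
      have hexp : exp (e.symm ((g : Aˣ) : A)) = (g : Aˣ) := e.right_inv hgt
      refine hinj _ _ ?_
      have hψg : ψ (g : Aˣ) = e.symm ((g : Aˣ) : A) := by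
        simp [hψ, hgt, hχ_eq_one _ hX]
      rw [hh]
      simp only [Set.Icc.coe_one, one_smul]
      rw [hψg]
      nth_rw 2 [← hexp]
      rw [exp_neg_mul_exp]
      rfl
    · simp [hv, hgt] at hg
  · intro g _ t ht c
    have hcomm : ∀ x : H, c * x = x * c ↔ Commute ((c : Aˣ) : A) ((x : Aˣ) : A) := fun x =>
      ⟨fun hx => congrArg (fun y : H => ((y : Aˣ) : A)) hx, fun hx => hinj _ _ hx⟩
    rw [hcomm, hcomm, hh]
    rcases hcases g with hg | ⟨X, -, hX4, hXg, hψX⟩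
    · simp [hg]
    · simp only
      rw [hψX, ← hXg, hmul]
      have hlt : (t : ℝ) * χ X < 1 := by nlinarith [hχ0 X, hχ1 X, t.2.1]
      exact commute_exp_smul_iff hX4 (by linarith) (by linarith [mul_nonneg t.2.1 (hχ0 X)])

/-- If `G` is a topologically closed subgroup of `GL_m(ℂ)`, then there are continuous maps
`u : G → [0,1]` and `h : [0,1] × G → G` representing `(G, {1_G})` as an NDR-pair such
that, in addition, for every `g ≠ 1_G` and every `t ∈ [0,1)` the centralizer of `h(t, g)`
in `G` equals the centralizer of `g` in `G`. -/
theorem closed_subgroup_GL_ndr_with_centralizers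
    (m : ℕ) (H : Subgroup (GL (Fin m) ℂ))
    (hH : IsClosed (H : Set (GL (Fin m) ℂ))) :
    ∃ (h : unitInterval × H → H) (u : H → ℝ),
      RepresentsNDR ({1} : Set H) h u ∧
      ∀ g : H, g ≠ 1 → ∀ t : unitInterval, (t : ℝ) < 1 →
        ∀ c : H, (c * h (t, g) = h (t, g) * c ↔ c * g = g * c) := by
  let := Matrix.linftyOpNormedRing (n := Fin m) (α := ℂ)
  let := Matrix.linftyOpNormedAlgebra (R := ℝ) (n := Fin m) (α := ℂ)
  exact Subgroup.exists_representsNDR_of_isClosed (A := Matrix (Fin m) (Fin m) ℂ) H hH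
end
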